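/- Let n ≥ 2 and let H be the subgroup of T_n consisting of elements fixing the point 0 (a copy of F_n inside T_n). Then H is undistorted in T_n: for any finite generating set S of H and any finite generating set Σ of T_n, there exist constants A ≥ 1 and B ≥ 0 such that for all ω ∈ H, (1/A)·|ω|_S − B ≤ |ω|_Σ ≤ A·|ω|_S + B. -/

import Mathlib

noncomputable section

namespace ThompsonPaper

/-- The circle `ℝ/ℤ`. -/
abbrev Circle : Type := AddCircle (1 : ℝ)

/-- Homeomorphisms of a topological space form a group under composition,
with `(f * g) x = f (g x)`. -/
instance homeoGroup {α : Type*} [TopologicalSpace α] : Group (α ≃ₜ α) where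
  mul f g := g.trans f
  one := Homeomorph.refl α
  inv := Homeomorph.symm
  mul_assoc _ _ _ := Homeomorph.ext fun _ => rfl
  one_mul _ := Homeomorph.ext fun _ => rfl
  mul_one _ := Homeomorph.ext fun _ => rfl
  inv_mul_cancel f := Homeomorph.ext fun x => f.symm_apply_apply x

/-- `x` is an `n`-adic rational: `x = a / n ^ k` with `a` an integer, `k` a natural number. -/
def IsNAdic (n : ℕ) (x : ℝ) : Prop := ∃ a : ℤ, ∃ k : ℕ, x = (a : ℝ) / (n : ℝ) ^ k

/-- The set of `n`-adic points of the circle. -/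
def nAdicPoints (n : ℕ) : Set Circle := { p | ∃ x : ℝ, IsNAdic n x ∧ p = (x : Circle) }

/-- `F : ℝ → ℝ` is a lift of the circle map `f`. -/
def IsLift (f : Circle ≃ₜ Circle) (F : ℝ → ℝ) : Prop :=
  ∀ x : ℝ, f (x : Circle) = ((F x : ℝ) : Circle)

/-- `F : ℝ → ℝ` commutes with translation by `1` and is piecewise affine with finitely
many breakpoints (modulo `1`), all breakpoints at `n`-adic rationals, and with the slope
of every affine piece an integer power of `n`. -/
def PiecewiseNAffine (n : ℕ) (F : ℝ → ℝ) : Prop :=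
  (∀ x : ℝ, F (x + 1) = F x + 1) ∧
  ∃ m : ℕ, ∃ t : ℕ → ℝ, ∃ slope : ℕ → ℤ, ∃ c : ℕ → ℝ,
    0 < m ∧ t 0 = 0 ∧ t m = 1 ∧
    (∀ i, i < m → t i < t (i + 1)) ∧
    (∀ i, i ≤ m → IsNAdic n (t i)) ∧
    (∀ i, i < m → ∀ x ∈ Set.Icc (t i) (t (i + 1)),
      F x = (n : ℝ) ^ (slope i) * x + c i)

/-- Membership in Thompson's group `T_n`: an orientation-preserving homeomorphism of the
circle `ℝ/ℤ` mapping the set of `n`-adic points onto itself, which is piecewise affine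
with finitely many breakpoints, all breakpoints at `n`-adic points, and all slopes integer
powers of `n`.  (Orientation preservation and the piecewise affine structure are expressed
through a strictly increasing lift.) -/
def InT (n : ℕ) (f : Circle ≃ₜ Circle) : Prop :=
  f '' nAdicPoints n = nAdicPoints n ∧
  ∃ F : ℝ → ℝ, StrictMono F ∧ IsLift f F ∧ PiecewiseNAffine n F

/-- Thompson's group `T_n`, as a set of circle homeomorphisms. -/
def TnSet (n : ℕ) : Set (Circle ≃ₜ Circle) := { f | InT n f }

/-- Thompson's group `T_n`, as a subgroup of the homeomorphism group of the circle.
(The set `TnSet n` is closed under the group operations, so this subgroup has exactly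
`TnSet n` as its underlying set.) -/
def Tn (n : ℕ) : Subgroup (Circle ≃ₜ Circle) := Subgroup.closure (TnSet n)

/-- The subgroup of `T_n` consisting of the elements fixing the point `0` of the circle
(a copy of `F_n` inside `T_n`). -/
def Fix0 (n : ℕ) : Subgroup (Tn n) where
  carrier := { g | (g : Circle ≃ₜ Circle) ((0 : ℝ) : Circle) = ((0 : ℝ) : Circle) }
  one_mem' := rfl
  mul_mem' := by
    intro a b ha hb
    show (a : Circle ≃ₜ Circle) ((b : Circle ≃ₜ Circle) _) = _
    rw [hb, ha]
  inv_mem' := by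
    intro a ha
    show ((a : Circle ≃ₜ Circle)).symm _ = _
    have h2 := congrArg ((a : Circle ≃ₜ Circle)).symm ha
    rw [Homeomorph.symm_apply_apply] at h2
    exact h2.symm

/-- The word length of `g` with respect to a set `S` of generators: the least `k` such
that `g` is a product of `k` elements of `S ∪ S⁻¹`. -/
def wordLength {G : Type*} [Group G] (S : Set G) (g : G) : ℕ :=
  sInf { k : ℕ | ∃ w : List G, w.length = k ∧ (∀ x ∈ w, x ∈ S ∨ x⁻¹ ∈ S) ∧ w.prod = g }

/-! ### n-adic numbers -/

lemma nadic_int (n : ℕ) (a : ℤ) : IsNAdic n (a : ℝ) := ⟨a, 0, by simp⟩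

lemma nadic_add {n : ℕ} (hn : 2 ≤ n) {x y : ℝ} (hx : IsNAdic n x) (hy : IsNAdic n y) :
    IsNAdic n (x + y) := by
  obtain ⟨a, k, rfl⟩ := hx
  obtain ⟨b, l, rfl⟩ := hy
  have h0 : (n : ℝ) ≠ 0 := by positivity
  refine ⟨a * n ^ l + b * n ^ k, k + l, ?_⟩
  push_cast
  field_simp
  ring

lemma nadic_neg {n : ℕ} {x : ℝ} (hx : IsNAdic n x) : IsNAdic n (-x) := by
  obtain ⟨a, k, rfl⟩ := hx
  exact ⟨-a, k, by push_cast; ring⟩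

lemma nadic_sub {n : ℕ} (hn : 2 ≤ n) {x y : ℝ} (hx : IsNAdic n x) (hy : IsNAdic n y) :
    IsNAdic n (x - y) := by
  rw [sub_eq_add_neg]; exact nadic_add hn hx (nadic_neg hy)

lemma nadic_mul {n : ℕ} {x y : ℝ} (hx : IsNAdic n x) (hy : IsNAdic n y) :
    IsNAdic n (x * y) := by
  obtain ⟨a, k, rfl⟩ := hx
  obtain ⟨b, l, rfl⟩ := hy
  refine ⟨a * b, k + l, ?_⟩
  push_cast
  rw [pow_add, mul_div_mul_comm]

lemma nadic_zpow (n : ℕ) (e : ℤ) : IsNAdic n ((n : ℝ) ^ e) := by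
  obtain ⟨k, rfl | rfl⟩ := e.eq_nat_or_neg
  · exact ⟨(n : ℤ) ^ k, 0, by simp⟩
  · exact ⟨1, k, by simp⟩

lemma nadic_div (n : ℕ) {x : ℝ} (hx : IsNAdic n x) : IsNAdic n (x / n) := by
  have := nadic_mul hx (nadic_zpow n (-1))
  simpa [div_eq_mul_inv] using this

/-- `f` is n-affine on `[a,b]`. -/
def NAff (n : ℕ) (f : ℝ → ℝ) (a b : ℝ) : Prop :=
  ∃ e : ℤ, ∃ c : ℝ, IsNAdic n c ∧ ∀ x, a ≤ x → x ≤ b → f x = (n : ℝ) ^ e * x + c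

/-! ### The model function -/

def Z (n : ℕ) (x : ℝ) : ℝ :=
  (n : ℝ) ^ (-⌊x / ((n : ℝ) - 1)⌋) *
    (1 - (x - ⌊x / ((n : ℝ) - 1)⌋ * ((n : ℝ) - 1)) / n)

lemma Z_formula {n : ℕ} (hn : 2 ≤ n) (k : ℤ) (x : ℝ) (h1 : k * ((n : ℝ) - 1) ≤ x)
    (h2 : x ≤ (k + 1) * ((n : ℝ) - 1)) :
    Z n x = (n : ℝ) ^ (-k) * (1 - (x - k * ((n : ℝ) - 1)) / n) := by
  have hn' : (2 : ℝ) ≤ n := by exact_mod_cast hn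
  have hp : (0 : ℝ) < (n : ℝ) - 1 := by linarith
  have h0 : (n : ℝ) ≠ 0 := by positivity
  rcases h2.lt_or_eq with h | h
  · have : ⌊x / ((n : ℝ) - 1)⌋ = k := by
      rw [Int.floor_eq_iff, le_div_iff₀ hp, div_lt_iff₀ hp]
      exact ⟨h1, h⟩
    unfold Z
    rw [this]
  · have : ⌊x / ((n : ℝ) - 1)⌋ = k + 1 := by
      rw [Int.floor_eq_iff, le_div_iff₀ hp, div_lt_iff₀ hp]
      push_cast
      constructor <;> nlinarith
    unfold Z
    rw [this, h, neg_add, zpow_add₀ h0, zpow_neg_one]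
    push_cast
    field_simp
    ring

lemma exists_cell {n : ℕ} (hn : 2 ≤ n) (x : ℝ) :
    ∃ k : ℤ, k * ((n : ℝ) - 1) ≤ x ∧ x < (k + 1) * ((n : ℝ) - 1) := by
  have hn' : (2 : ℝ) ≤ n := by exact_mod_cast hn
  have hp : (0 : ℝ) < (n : ℝ) - 1 := by linarith
  refine ⟨⌊x / ((n : ℝ) - 1)⌋, ?_, ?_⟩
  · rw [← le_div_iff₀ hp]; exact Int.floor_le _
  · rw [← div_lt_iff₀ hp]; exact Int.lt_floor_add_one _

lemma Z_shift {n : ℕ} (hn : 2 ≤ n) (x : ℝ) (m : ℤ) :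
    Z n (x + m * ((n : ℝ) - 1)) = (n : ℝ) ^ (-m) * Z n x := by
  have h0 : (n : ℝ) ≠ 0 := by positivity
  obtain ⟨k, h1, h2⟩ := exists_cell hn x
  rw [Z_formula hn k x h1 h2.le, Z_formula hn (k + m) (x + m * ((n : ℝ) - 1))
    (by push_cast; linarith) (by push_cast; linarith), neg_add, zpow_add₀ h0]
  push_cast
  ring

lemma Z_bounds {n : ℕ} (hn : 2 ≤ n) (k : ℤ) (x : ℝ) (h1 : k * ((n : ℝ) - 1) ≤ x)
    (h2 : x < (k + 1) * ((n : ℝ) - 1)) :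
    (n : ℝ) ^ (-(k + 1)) < Z n x ∧ Z n x ≤ (n : ℝ) ^ (-k) := by
  have hn' : (2 : ℝ) ≤ n := by exact_mod_cast hn
  have h0 : (n : ℝ) ≠ 0 := by positivity
  have hp : (0 : ℝ) < (n : ℝ) ^ (-k) := by positivity
  rw [Z_formula hn k x h1 h2.le, neg_add, zpow_add₀ h0]
  constructor
  · apply mul_lt_mul_of_pos_left _ hp
    rw [zpow_neg_one, inv_eq_one_div, lt_sub_iff_add_lt, ← add_div, div_lt_one (by positivity)]
    linarith
  · have : 0 ≤ (x - k * ((n : ℝ) - 1)) / n := div_nonneg (by linarith) (by positivity)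
    nlinarith

lemma Z_pos {n : ℕ} (hn : 2 ≤ n) (x : ℝ) : 0 < Z n x := by
  obtain ⟨k, h1, h2⟩ := exists_cell hn x
  have : (0 : ℝ) < (n : ℝ) ^ (-(k + 1)) := by positivity
  exact this.trans (Z_bounds hn k x h1 h2).1

lemma Z_anti {n : ℕ} (hn : 2 ≤ n) : StrictAnti (Z n) := by
  intro x y hxy
  have hn' : (2 : ℝ) ≤ n := by exact_mod_cast hn
  have hp : (0 : ℝ) < (n : ℝ) - 1 := by linarith
  obtain ⟨k, h1, h2⟩ := exists_cell hn x
  obtain ⟨l, h3, h4⟩ := exists_cell hn y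
  have hkl : k < l + 1 := by
    have : (k : ℝ) * ((n : ℝ) - 1) < (l + 1) * ((n : ℝ) - 1) := by linarith
    have := lt_of_mul_lt_mul_right this hp.le
    exact_mod_cast this
  rcases (Int.lt_add_one_iff.mp hkl).lt_or_eq with h | h
  · calc Z n y ≤ (n : ℝ) ^ (-l) := (Z_bounds hn l y h3 h4).2
      _ ≤ (n : ℝ) ^ (-(k + 1)) := zpow_le_zpow_right₀ (by linarith) (by omega)
      _ < Z n x := (Z_bounds hn k x h1 h2).1
  · subst h
    rw [Z_formula hn k x h1 h2.le, Z_formula hn k y h3 h4.le]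
    apply mul_lt_mul_of_pos_left _ (by positivity)
    have : (x - k * ((n : ℝ) - 1)) / n < (y - k * ((n : ℝ) - 1)) / n := by
      apply div_lt_div_of_pos_right _ (by positivity)
      linarith
    linarith

lemma Z_surj {n : ℕ} (hn : 2 ≤ n) (z : ℝ) (hz : 0 < z) : ∃ x, Z n x = z := by
  have hn' : (2 : ℝ) ≤ n := by exact_mod_cast hn
  have h0 : (n : ℝ) ≠ 0 := by positivity
  obtain ⟨m, h1, h2⟩ := exists_mem_Ioc_zpow hz (show (1 : ℝ) < n by linarith)
  have hpm : (0 : ℝ) < (n : ℝ) ^ (m + 1) := by positivity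
  have hpm' : (0 : ℝ) < (n : ℝ) ^ m := by positivity
  have e1 : (n : ℝ) ^ (m + 1) = n ^ m * n := by rw [zpow_add₀ h0, zpow_one]
  set r := z / (n : ℝ) ^ (m + 1) with hr
  have hz' : z = (n : ℝ) ^ (m + 1) * r := by rw [hr]; field_simp
  have r1 : r ≤ 1 := by rw [hr, div_le_one hpm]; exact h2
  have r2 : 1 ≤ n * r := by
    have : (n : ℝ) ^ m * 1 ≤ (n : ℝ) ^ m * (n * r) := by
      rw [← mul_assoc, ← e1, ← hz']; linarith
    exact le_of_mul_le_mul_left this hpm'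
  refine ⟨(-(m + 1) : ℤ) * ((n : ℝ) - 1) + n * (1 - r), ?_⟩
  rw [Z_formula hn (-(m + 1)) _ (by nlinarith) (by nlinarith)]
  rw [neg_neg, hz']
  field_simp
  ring

lemma Z_aff {n : ℕ} (hn : 2 ≤ n) (j : ℤ) :
    ∃ e : ℤ, ∃ c : ℝ, IsNAdic n c ∧ ∀ x : ℝ, (j : ℝ) ≤ x → x ≤ j + 1 →
      Z n x = -(n : ℝ) ^ e * x + c := by
  have h0 : (n : ℝ) ≠ 0 := by positivity
  obtain ⟨k, h1, h2⟩ := exists_cell hn (j : ℝ)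
  have h3 : (j : ℝ) + 1 ≤ (k + 1) * ((n : ℝ) - 1) := by
    have : j < (k + 1) * ((n : ℤ) - 1) := by
      have : ((j : ℤ) : ℝ) < (((k + 1) * ((n : ℤ) - 1) : ℤ) : ℝ) := by push_cast; exact h2
      exact_mod_cast this
    have := Int.add_one_le_iff.mpr this
    exact_mod_cast this
  refine ⟨-k + -1, (n : ℝ) ^ (-k) + (n : ℝ) ^ (-k + -1) * ((k * ((n : ℤ) - 1) : ℤ) : ℝ),
    nadic_add hn (nadic_zpow _ _) (nadic_mul (nadic_zpow _ _) (nadic_int _ _)), ?_⟩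
  intro x hx1 hx2
  rw [Z_formula hn k x (by linarith) (by linarith), zpow_add₀ h0 (-k) (-1), zpow_neg_one]
  push_cast
  field_simp
  ring

lemma Z_small {n : ℕ} (hn : 2 ≤ n) (x : ℝ) (h1 : 0 ≤ x) (h2 : x ≤ (n : ℝ) - 1) :
    Z n x = 1 - x / n := by
  rw [Z_formula hn 0 x (by simpa using h1) (by simpa using h2)]
  simp

/-! ### Charts -/

structure IsChart (n : ℕ) (p : ℝ) (a b : ℤ) (f : ℝ → ℝ) : Prop where
  mono : StrictMono f
  lo : ∀ x, p < f x
  hi : ∀ x, f x < p + 1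
  surj : ∀ y, p < y → y < p + 1 → ∃ x, f x = y
  aff : ∀ j : ℤ, NAff n f j (j + 1)
  left : ∃ N : ℤ, ∀ x : ℝ, x ≤ N → f x = p + Z n (a - x)
  right : ∃ N : ℤ, ∀ x : ℝ, N ≤ x → f x = p + 1 - Z n (x - b)
  nadic : IsNAdic n p
  zero : f 0 = 1

def Bf (n d : ℕ) (x : ℝ) : ℝ :=
  if x ≤ 0 then (d : ℝ) / n + Z n (d - x) else (d : ℝ) / n + 1 - Z n (x + n - d)

lemma Bf_left (n d : ℕ) (x : ℝ) (hx : x ≤ 0) : Bf n d x = (d : ℝ) / n + Z n (d - x) := by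
  simp [Bf, hx]

lemma Bf_right {n d : ℕ} (hn : 2 ≤ n) (hd : 1 ≤ d) (hdn : d < n) (x : ℝ) (hx : 0 ≤ x) :
    Bf n d x = (d : ℝ) / n + 1 - Z n (x + n - d) := by
  rcases hx.lt_or_eq with h | h
  · simp [Bf, not_le.mpr h]
  · subst h
    have hd' : (1 : ℝ) ≤ d := by exact_mod_cast hd
    have hdn' : (d : ℝ) + 1 ≤ n := by exact_mod_cast hdn
    rw [Bf_left _ _ _ le_rfl, Z_small hn _ (by linarith) (by linarith),
      Z_small hn _ (by linarith) (by linarith)]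
    field_simp
    ring

lemma Bf_chart {n d : ℕ} (hn : 2 ≤ n) (hd : 1 ≤ d) (hdn : d < n) :
    IsChart n ((d : ℝ) / n) d (d - n) (Bf n d) := by
  have hd' : (1 : ℝ) ≤ d := by exact_mod_cast hd
  have hdn' : (d : ℝ) + 1 ≤ n := by exact_mod_cast hdn
  have hL := Bf_left n d
  have hR := Bf_right hn hd hdn
  have hz : Bf n d 0 = 1 := by
    rw [hL _ le_rfl, Z_small hn _ (by linarith) (by linarith)]
    ring
  have hm : StrictMono (Bf n d) := by
    apply StrictMonoOn.Iic_union_Ici (a := 0)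
    · intro x hx y hy hxy
      rw [hL x hx, hL y hy]
      have := Z_anti hn (show (d : ℝ) - y < d - x by linarith)
      linarith
    · intro x hx y hy hxy
      rw [hR x hx, hR y hy]
      have := Z_anti hn (show x + n - (d : ℝ) < y + n - d by linarith)
      linarith
  have hdl : (d : ℝ) / n < 1 := by rw [div_lt_one (by linarith)]; linarith
  have hdp : 0 < (d : ℝ) / n := div_pos (by linarith) (by linarith)
  refine ⟨hm, ?_, ?_, ?_, ?_, ⟨0, ?_⟩, ⟨0, ?_⟩, ?_, hz⟩
  · intro x
    rcases le_total x 0 with h | h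
    · rw [hL x h]; linarith [Z_pos hn (d - x)]
    · have := hm.monotone h; linarith
  · intro x
    rcases le_total 0 x with h | h
    · rw [hR x h]; linarith [Z_pos hn (x + n - d)]
    · have := hm.monotone h; linarith
  · intro y h1 h2
    rcases le_total y 1 with h | h
    · obtain ⟨x, hx⟩ := Z_surj hn (y - d / n) (by linarith)
      have : (d : ℝ) ≤ x := by
        rw [← (Z_anti hn).le_iff_ge, hx, Z_small hn _ (by linarith) (by linarith)]; linarith
      refine ⟨d - x, ?_⟩
      rw [hL _ (by linarith), sub_sub_cancel, hx]; ring
    · obtain ⟨x, hx⟩ := Z_surj hn (d / n + 1 - y) (by linarith)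
      have : (n : ℝ) - d ≤ x := by
        rw [← (Z_anti hn).le_iff_ge, hx, Z_small hn _ (by linarith) (by linarith)]
        have : ((n : ℝ) - d) / n = 1 - d / n := by field_simp
        linarith
      refine ⟨x - n + d, ?_⟩
      rw [hR _ (by linarith)]
      have : x - n + d + n - (d : ℝ) = x := by ring
      rw [this, hx]; ring
  · intro j
    rcases lt_or_ge j 0 with h | h
    · obtain ⟨e, c, hc, H⟩ := Z_aff hn (d - j - 1)
      have h' : (j : ℝ) + 1 ≤ 0 := by exact_mod_cast h
      refine ⟨e, (d : ℤ) / n + (- (n : ℝ) ^ e * ((d : ℤ) : ℝ) + c), nadic_add hn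
        (nadic_div n (nadic_int n d)) (nadic_add hn (nadic_mul (nadic_neg (nadic_zpow _ _))
        (nadic_int n _)) hc), ?_⟩
      intro x h1 h2
      rw [hL x (by linarith), H _ (by push_cast; linarith) (by push_cast; linarith)]
      push_cast
      ring
    · obtain ⟨e, c, hc, H⟩ := Z_aff hn (j + n - d)
      have h' : (0 : ℝ) ≤ j := by exact_mod_cast h
      refine ⟨e, (d : ℤ) / n + ((1 : ℤ) + ((n : ℝ) ^ e * ((n - d : ℤ) : ℝ) - c)), nadic_add hn
        (nadic_div n (nadic_int n d)) (nadic_add hn (nadic_int n 1)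
        (nadic_sub hn (nadic_mul ((nadic_zpow _ _))
        (nadic_int n _)) hc)), ?_⟩
      intro x h1 h2
      rw [hR x (by linarith), H _ (by push_cast; linarith) (by push_cast; linarith)]
      push_cast
      ring
  · intro x hx
    rw [hL x (by simpa using hx)]; simp
  · intro x hx
    rw [hR x (by simpa using hx)]; push_cast; ring_nf
  · simpa using nadic_div n (nadic_int n d)

def stepf (n : ℕ) (c : ℕ) (f : ℝ → ℝ) (x : ℝ) : ℝ :=
  if x ≤ -((n : ℝ) - 1 - c) then (c + f (x + ((n : ℝ) - 1 - c))) / n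
  else if x ≤ c then 1 + x / n
  else (c + f (x - c)) / n + ((n : ℝ) - 1) / n

section step
variable {n c : ℕ} {f : ℝ → ℝ}

lemma stepf_left (x : ℝ) (hx : x ≤ -((n : ℝ) - 1 - c)) :
    stepf n c f x = (c + f (x + ((n : ℝ) - 1 - c))) / n := by
  simp only [stepf, hx, if_true]

lemma stepf_mid (hn : 2 ≤ n) (hf : f 0 = 1) (x : ℝ) (hx : -((n : ℝ) - 1 - c) ≤ x)
    (hx' : x ≤ c) : stepf n c f x = 1 + x / n := by
  have h0 : (n : ℝ) ≠ 0 := by positivity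
  rcases hx.lt_or_eq with h | h
  · simp only [stepf, not_le.mpr h, hx', if_true, if_false]
  · rw [stepf_left x h.ge, ← h, neg_add_cancel, hf]
    field_simp
    ring

lemma stepf_right (hn : 2 ≤ n) (hc : c < n) (hf : f 0 = 1) (x : ℝ) (hx : c ≤ x) :
    stepf n c f x = (c + f (x - c)) / n + ((n : ℝ) - 1) / n := by
  have h0 : (n : ℝ) ≠ 0 := by positivity
  have hc' : (c : ℝ) + 1 ≤ n := by exact_mod_cast hc
  rcases hx.lt_or_eq with h | h
  · have : ¬ x ≤ -((n : ℝ) - 1 - c) := by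
      have : (0 : ℝ) ≤ c := by positivity
      intro h; linarith
    simp only [stepf, not_le.mpr h, this, if_false]
  · rw [stepf_mid hn hf x (by linarith [(Nat.cast_nonneg c : (0 : ℝ) ≤ c)]) h.ge, ← h, sub_self, hf]
    field_simp
    ring

lemma step_chart (hn : 2 ≤ n) (hc : c < n) {p : ℝ} {a b : ℤ} (hf : IsChart n p a b f) :
    IsChart n ((c + p) / n) (a + c) (b + c - (n - 1)) (stepf n c f) := by
  have h0 : (n : ℝ) ≠ 0 := by positivity
  have hn0 : (0 : ℝ) < n := by positivity
  have hc0 : (0 : ℝ) ≤ c := by positivity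
  have hc' : (c : ℝ) + 1 ≤ n := by exact_mod_cast hc
  have hL : ∀ x : ℝ, x ≤ -((n : ℝ) - 1 - c) → stepf n c f x = _ := stepf_left
  have hM := stepf_mid (c := c) hn hf.zero
  have hR := stepf_right hn hc hf.zero
  have hm : StrictMono (stepf n c f) := by
    apply StrictMonoOn.Iic_union_Ici (a := (c : ℝ))
    · have hu : Set.Iic (c : ℝ) = Set.Iic (-((n : ℝ) - 1 - c)) ∪ Set.Icc (-((n : ℝ) - 1 - c)) c := by
        rw [Set.Iic_union_Icc_eq_Iic]; linarith
      rw [hu]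
      apply StrictMonoOn.union (c := -((n : ℝ) - 1 - c))
      · intro x hx y hy hxy
        rw [hL x hx, hL y hy]
        have := hf.mono (show x + ((n : ℝ) - 1 - c) < y + ((n : ℝ) - 1 - c) by linarith)
        apply div_lt_div_of_pos_right _ hn0
        linarith
      · intro x hx y hy hxy
        rw [hM x hx.1 hx.2, hM y hy.1 hy.2]
        have := div_lt_div_of_pos_right hxy hn0
        linarith
      · exact isGreatest_Iic
      · exact isLeast_Icc (by linarith)
    · intro x hx y hy hxy
      rw [hR x hx, hR y hy]
      have := hf.mono (show x - c < y - (c : ℝ) by linarith)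
      have := div_lt_div_of_pos_right (show c + f (x - c) < c + f (y - c) by linarith) hn0
      linarith
  have hz : stepf n c f 0 = 1 := by rw [hM 0 (by linarith) hc0]; simp
  have e1 : ((n : ℝ) - 1) / n = 1 - 1 / n := by field_simp
  refine ⟨hm, ?_, ?_, ?_, ?_, ?_, ?_, ?_, hz⟩
  · have key : ∀ x : ℝ, x ≤ -((n : ℝ) - 1 - c) → (c + p) / n < stepf n c f x := by
      intro x h
      rw [hL x h]
      apply div_lt_div_of_pos_right _ hn0
      linarith [hf.lo (x + ((n : ℝ) - 1 - c))]
    intro x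
    rcases le_total x (-((n : ℝ) - 1 - c)) with h | h
    · exact key x h
    · exact (key _ le_rfl).trans_le (hm.monotone h)
  · have key : ∀ x : ℝ, c ≤ x → stepf n c f x < (c + p) / n + 1 := by
      intro x h
      rw [hR x h, e1]
      have := div_lt_div_of_pos_right (show c + f (x - c) < c + p + 1 by linarith [hf.hi (x - c)]) hn0
      rw [add_div (c + p)] at this
      linarith
    intro x
    rcases le_total (c : ℝ) x with h | h
    · exact key x h
    · exact (hm.monotone h).trans_lt (key _ le_rfl)
  · intro y h1 h2
    rcases le_total y ((c + 1) / n) with h | h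
    · rw [div_lt_iff₀ hn0] at h1
      rw [le_div_iff₀ hn0] at h
      have p1 := hf.lo 0
      have p2 := hf.hi 0
      rw [hf.zero] at p1 p2
      obtain ⟨x, hx⟩ := hf.surj (y * n - c) (by linarith) (by linarith)
      have : x ≤ 0 := by rw [← hf.mono.le_iff_le, hx, hf.zero]; linarith
      refine ⟨x - (n - 1 - c), ?_⟩
      rw [hL _ (by linarith), sub_add_cancel, hx]
      field_simp
      ring
    · rcases le_total y (1 + c / n) with h' | h'
      · rw [div_le_iff₀ hn0] at h
        refine ⟨(y - 1) * n, ?_⟩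
        have : (y - 1) * n ≤ c := by
          rw [← le_div_iff₀ hn0]; linarith
        rw [hM _ (by linarith) this]
        field_simp
        ring
      · have p1 := hf.lo 0
        have p2 := hf.hi 0
        rw [hf.zero] at p1 p2
        have q1 : (c : ℝ) ≤ (y - 1) * n := by rw [← div_le_iff₀ hn0]; linarith
        have q2 : (y - 1) * n < c + p := by rw [← lt_div_iff₀ hn0]; linarith
        obtain ⟨x, hx⟩ := hf.surj ((y - 1) * n - c + 1) (by linarith) (by linarith)
        have : 0 ≤ x := by rw [← hf.mono.le_iff_le, hx, hf.zero]; linarith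
        refine ⟨x + c, ?_⟩
        rw [hR _ (by linarith), add_sub_cancel_right, hx]
        field_simp
        ring
  · intro j
    have hnc : IsNAdic n ((c : ℤ) : ℝ) := nadic_int n c
    rcases lt_or_ge j (-((n : ℤ) - 1 - c)) with h | h
    · have h' : (j : ℝ) + 1 ≤ -((n : ℝ) - 1 - c) := by exact_mod_cast h
      obtain ⟨e, q, hq, H⟩ := hf.aff (j + (n - 1 - c))
      refine ⟨e - 1, ((c : ℤ) + (n : ℝ) ^ e * ((n - 1 - c : ℤ) : ℝ) + q) / n,
        nadic_div n (nadic_add hn (nadic_add hn hnc (nadic_mul (nadic_zpow _ _) (nadic_int n _))) hq), ?_⟩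
      intro x h1 h2
      rw [hL x (by linarith), H _ (by push_cast; linarith) (by push_cast; linarith), zpow_sub_one₀ h0]
      push_cast
      field_simp
      ring
    · have h' : -((n : ℝ) - 1 - c) ≤ j := by exact_mod_cast h
      rcases lt_or_ge j c with h2 | h2
      · have h3 : (j : ℝ) + 1 ≤ c := by exact_mod_cast h2
        refine ⟨-1, (1 : ℤ), nadic_int n 1, ?_⟩
        intro x h1 h2
        rw [hM x (by linarith) (by linarith)]
        simp
        ring
      · have h3 : (c : ℝ) ≤ j := by exact_mod_cast h2
        obtain ⟨e, q, hq, H⟩ := hf.aff (j - c)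
        refine ⟨e - 1, ((c : ℤ) - (n : ℝ) ^ e * ((c : ℤ) : ℝ) + q) / n + ((n - 1 : ℤ) : ℝ) / n,
          nadic_add hn (nadic_div n (nadic_add hn (nadic_sub hn hnc (nadic_mul (nadic_zpow _ _)
          (nadic_int n _))) hq)) (nadic_div n (nadic_int n _)), ?_⟩
        intro x h1 h2
        rw [hR x (by linarith), H _ (by push_cast; linarith) (by push_cast; linarith), zpow_sub_one₀ h0]
        push_cast
        field_simp
        ring
  · obtain ⟨N, hN⟩ := hf.left
    refine ⟨min (N - (n - 1 - c)) (-(n - 1 - c)), ?_⟩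
    intro x hx
    push_cast at hx
    have hx1 := hx.trans (min_le_left _ _)
    have hx2 := hx.trans (min_le_right _ _)
    rw [hL x hx2, hN _ (by linarith)]
    have := Z_shift hn (a - (x + (n - 1 - c))) 1
    rw [zpow_neg_one] at this
    have e : ((a + c : ℤ) : ℝ) - x = a - (x + (n - 1 - c)) + ((1 : ℤ) : ℝ) * (n - 1) := by
      push_cast; ring
    rw [e, this]
    field_simp
    ring
  · obtain ⟨N, hN⟩ := hf.right
    refine ⟨max (N + c) c, ?_⟩
    intro x hx
    push_cast at hx
    have hx1 := (le_max_left _ _).trans hx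
    have hx2 := (le_max_right _ _).trans hx
    rw [hR x hx2, hN _ (by linarith)]
    have := Z_shift hn (x - c - b) 1
    rw [zpow_neg_one] at this
    have e : x - ((b + c - (n - 1) : ℤ) : ℝ) = x - c - b + ((1 : ℤ) : ℝ) * (n - 1) := by
      push_cast; ring
    rw [e, this]
    field_simp
    ring
  · exact nadic_div n (nadic_add hn (by exact_mod_cast nadic_int n c) hf.nadic)

end step

/-! ### Words -/

section words
variable {n : ℕ}

def rho (d : ℕ) : List (Fin n) → ℝ → ℝ
  | [] => Bf n d
  | c :: w => stepf n c (rho d w)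

def pt (d : ℕ) : List (Fin n) → ℝ
  | [] => (d : ℝ) / n
  | c :: w => ((c : ℕ) + pt d w) / n

def dsum : List (Fin n) → ℤ
  | [] => 0
  | c :: w => (c : ℕ) + dsum w

def num : List (Fin n) → ℤ
  | [] => 0
  | c :: w => (c : ℕ) * (n : ℤ) ^ w.length + num w

/-- number of hanging pieces on the right -/
def rsum (u : List (Fin n)) : ℝ := u.length * ((n : ℝ) - 1) - dsum u

lemma rsum_cons (c : Fin n) (u : List (Fin n)) :
    rsum (c :: u) = ((n : ℝ) - 1 - (c : ℕ)) + rsum u := by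
  simp only [rsum, dsum, List.length_cons]; push_cast; ring

lemma dsum_nonneg (u : List (Fin n)) : (0 : ℤ) ≤ dsum u := by
  induction u with
  | nil => simp [dsum]
  | cons c u ih => simp only [dsum]; omega

lemma rsum_nonneg (u : List (Fin n)) : 0 ≤ rsum u := by
  induction u with
  | nil => simp [rsum, dsum]
  | cons c u ih =>
    rw [rsum_cons]
    have : ((c : ℕ) : ℝ) + 1 ≤ n := by exact_mod_cast c.2
    linarith

lemma dsum_append (u w : List (Fin n)) : dsum (u ++ w) = dsum u + dsum w := by
  induction u with
  | nil => simp [dsum]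
  | cons c u ih => simp only [dsum, List.cons_append, ih]; ring

lemma rho_chart (hn : 2 ≤ n) {d : ℕ} (hd : 1 ≤ d) (hdn : d < n) (w : List (Fin n)) :
    IsChart n (pt d w) (d + dsum w) (d + dsum w - n - w.length * (n - 1)) (rho d w) := by
  induction w with
  | nil => simpa [pt, dsum, rho] using Bf_chart hn hd hdn
  | cons c w ih =>
    have := step_chart hn c.2 ih
    convert this using 1
    · rfl
    · simp only [dsum]; ring
    · simp only [dsum, List.length_cons]; push_cast; ring
    · rfl

lemma pt_pos (hn : 2 ≤ n) {d : ℕ} (hd : 1 ≤ d) (w : List (Fin n)) : 0 < pt d w := by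
  induction w with
  | nil => simp only [pt]; positivity
  | cons c w ih => simp only [pt]; positivity

lemma pt_lt (hn : 2 ≤ n) {d : ℕ} (hdn : d < n) (w : List (Fin n)) : pt d w < 1 := by
  have hn0 : (0 : ℝ) < n := by positivity
  induction w with
  | nil => simp only [pt]; rw [div_lt_one hn0]; exact_mod_cast hdn
  | cons c w ih =>
    simp only [pt]; rw [div_lt_one hn0]
    have : ((c : ℕ) : ℝ) + 1 ≤ n := by exact_mod_cast c.2
    linarith

lemma pt_append (hn : 2 ≤ n) (d : ℕ) (u w : List (Fin n)) :
    pt d (u ++ w) = (num u + pt d w) / (n : ℝ) ^ u.length := by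
  have h0 : (n : ℝ) ≠ 0 := by positivity
  induction u with
  | nil => simp [num]
  | cons c u ih =>
    simp only [List.cons_append, pt, ih, num, List.length_cons]
    push_cast
    rw [pow_succ]
    field_simp
    ring

lemma rho_append_left (hn : 2 ≤ n) (d : ℕ) (u w : List (Fin n)) (y : ℝ) (hy : y ≤ - rsum u) :
    rho d (u ++ w) y = (num u + rho d w (y + rsum u)) / (n : ℝ) ^ u.length := by
  have h0 : (n : ℝ) ≠ 0 := by positivity
  induction u generalizing y with
  | nil => simp [num, rsum, dsum]
  | cons c u ih =>
    have := rsum_nonneg u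
    rw [rsum_cons] at hy ⊢
    simp only [List.cons_append, rho, num, List.length_cons]
    rw [stepf_left _ (by linarith), ih _ (by linarith)]
    have e : y + (↑n - 1 - ↑↑c) + rsum u = y + (↑n - 1 - ↑↑c + rsum u) := by ring
    rw [e]
    push_cast
    rw [pow_succ]
    field_simp
    ring

lemma rho_append_right (hn : 2 ≤ n) {d : ℕ} (hd : 1 ≤ d) (hdn : d < n) (u w : List (Fin n))
    (y : ℝ) (hy : dsum u ≤ y) :
    rho d (u ++ w) y = (num u + rho d w (y - dsum u) - 1) / (n : ℝ) ^ u.length + 1 := by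
  have h0 : (n : ℝ) ≠ 0 := by positivity
  induction u generalizing y with
  | nil => simp [num, dsum]
  | cons c u ih =>
    have h1 : (0 : ℝ) ≤ dsum u := by exact_mod_cast dsum_nonneg u
    simp only [dsum] at hy ⊢
    push_cast at hy ⊢
    simp only [List.cons_append, rho, num, List.length_cons]
    rw [stepf_right hn c.2 (rho_chart hn hd hdn _).zero _ (by linarith), ih _ (by linarith)]
    have e : y - (c : ℕ) - dsum u = y - ((c : ℕ) + dsum u) := by ring
    rw [e]
    push_cast
    rw [pow_succ]
    field_simp
    ring

lemma rho_append_mid (hn : 2 ≤ n) {d d' : ℕ} (hd : 1 ≤ d) (hdn : d < n) (hd' : 1 ≤ d')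
    (hdn' : d' < n) (u w w' : List (Fin n)) (y : ℝ) (hy : - rsum u ≤ y) (hy' : y ≤ dsum u) :
    rho d (u ++ w) y = rho d' (u ++ w') y := by
  induction u generalizing y with
  | nil =>
    have : y = 0 := by
      simp [rsum, dsum] at hy hy'; linarith
    subst this
    rw [(rho_chart hn hd hdn _).zero, (rho_chart hn hd' hdn' _).zero]
  | cons c u ih =>
    have z1 := (rho_chart hn hd hdn (u ++ w)).zero
    have z2 := (rho_chart hn hd' hdn' (u ++ w')).zero
    have := rsum_nonneg u
    have h1 : (0 : ℝ) ≤ dsum u := by exact_mod_cast dsum_nonneg u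
    rw [rsum_cons] at hy
    simp only [dsum] at hy'
    push_cast at hy'
    simp only [List.cons_append, rho]
    rcases le_total y (-((n : ℝ) - 1 - (c : ℕ))) with h | h
    · rw [stepf_left _ h, stepf_left _ h, ih _ (by linarith) (by linarith)]
    · rcases le_total y (c : ℕ) with h' | h'
      · rw [stepf_mid hn z1 _ h h', stepf_mid hn z2 _ h h']
      · rw [stepf_right hn c.2 z1 _ h', stepf_right hn c.2 z2 _ h', ih _ (by linarith) (by linarith)]

lemma exists_word (hn : 2 ≤ n) (K : ℕ) (J : ℤ) :
    ∃ v : List (Fin n), ∃ m : ℤ, v.length = K ∧ J = num v + m * (n : ℤ) ^ K := by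
  induction K with
  | zero => exact ⟨[], J, rfl, by simp [num]⟩
  | succ K ih =>
    obtain ⟨v, m, hv, h⟩ := ih
    have hn0 : (0 : ℤ) < n := by positivity
    have h1 := Int.emod_nonneg m hn0.ne'
    have h2 := Int.emod_lt_of_pos m hn0
    refine ⟨⟨(m % n).toNat, by omega⟩ :: v, m / n, by simp [hv], ?_⟩
    simp only [num, hv]
    rw [Int.toNat_of_nonneg h1]
    have h3 := Int.emod_add_mul_ediv m n
    rw [h, pow_succ]
    nth_rewrite 1 [← h3]
    ring

lemma exists_code (hn : 2 ≤ n) (p : ℝ) (hp : IsNAdic n p) (h0 : 0 < p) (h1 : p < 1) :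
    ∃ d : ℕ, 1 ≤ d ∧ d < n ∧ ∃ w : List (Fin n), p = pt d w := by
  have hnn : (n : ℝ) ≠ 0 := by positivity
  have hn0 : (0 : ℝ) < n := by positivity
  obtain ⟨a, k, rfl⟩ := hp
  induction k generalizing a with
  | zero =>
    simp at h0 h1
    have : a < 1 := by exact_mod_cast h1
    omega
  | succ k ih =>
    set q : ℝ := (a : ℝ) / n ^ k with hq
    have hpq : (a : ℝ) / n ^ (k + 1) = q / n := by rw [hq, pow_succ]; field_simp
    rw [hpq] at h0 h1 ⊢
    rw [div_lt_one hn0] at h1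
    have hq0 : 0 < q := by
      have := mul_pos h0 hn0
      rwa [div_mul_cancel₀ _ hnn] at this
    obtain ⟨c, hc⟩ : ∃ c : ℕ, ⌊q⌋ = c := ⟨⌊q⌋.toNat, by
      rw [Int.toNat_of_nonneg (Int.floor_nonneg.mpr hq0.le)]⟩
    rw [Int.floor_eq_iff] at hc
    push_cast at hc
    have hcn : c < n := by
      have : (c : ℝ) < n := by linarith
      exact_mod_cast this
    rcases hc.1.lt_or_eq with h | h
    · have e : q - c = ((a - c * n ^ k : ℤ) : ℝ) / n ^ k := by
        rw [hq]; push_cast; field_simp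
      obtain ⟨d, hd, hdn, w, hw⟩ := ih (a - c * n ^ k) (by rw [← e]; linarith) (by rw [← e]; linarith)
      refine ⟨d, hd, hdn, ⟨c, hcn⟩ :: w, ?_⟩
      simp only [pt]
      rw [← hw, ← e]
      ring
    · refine ⟨c, ?_, hcn, [], by simp [pt, h]⟩
      rcases Nat.eq_zero_or_pos c with h' | h'
      · subst h'; simp at h; linarith
      · exact h'

lemma pt_inj (hn : 2 ≤ n) {d d' : ℕ} (hd : 1 ≤ d) (hdn : d < n) (hd' : 1 ≤ d')
    (hdn' : d' < n) (w w' : List (Fin n)) (h : pt d w = pt d' w') : d = d' ∧ w = w' := by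
  have hnn : (n : ℝ) ≠ 0 := by positivity
  have key : ∀ (a b : ℕ) (x y : ℝ), 0 ≤ x → x < 1 → 0 ≤ y → y < 1 → (a + x) / n = (b + y) / n →
      a = b ∧ x = y := by
    intro a b x y h1 h2 h3 h4 h5
    rw [div_left_inj' hnn] at h5
    have ha : (a : ℝ) < b + 1 := by linarith
    have hb : (b : ℝ) < a + 1 := by linarith
    have ha' : a < b + 1 := by exact_mod_cast ha
    have hb' : b < a + 1 := by exact_mod_cast hb
    have : a = b := by omega
    subst this
    exact ⟨rfl, by linarith⟩
  induction w generalizing w' with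
  | nil =>
    cases w' with
    | nil =>
      simp only [pt] at h
      rw [div_left_inj' hnn] at h
      exact ⟨by exact_mod_cast h, rfl⟩
    | cons c w' =>
      simp only [pt] at h
      have := key d c 0 (pt d' w') le_rfl one_pos (pt_pos hn hd' w').le (pt_lt hn hdn' w') (by simpa using h)
      exact absurd this.2 (pt_pos hn hd' w').ne
  | cons c w ih =>
    cases w' with
    | nil =>
      simp only [pt] at h
      have := key c d' (pt d w) 0 (pt_pos hn hd w).le (pt_lt hn hdn w) le_rfl one_pos (by simpa using h)
      exact absurd this.2 (pt_pos hn hd w).ne'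
    | cons c' w' =>
      simp only [pt] at h
      have := key c c' (pt d w) (pt d' w') (pt_pos hn hd w).le (pt_lt hn hdn w)
        (pt_pos hn hd' w').le (pt_lt hn hdn' w') h
      obtain ⟨h1, h2⟩ := ih w' this.2
      exact ⟨h1, by rw [h2, Fin.ext this.1]⟩

end words

/-! ### Building elements of `T_n` -/

lemma circleHomeo (F : ℝ ≃ₜ ℝ) (hF : ∀ x, F (x + 1) = F x + 1) :
    ∃ f : Circle ≃ₜ Circle, ∀ x : ℝ, f (x : Circle) = ((F x : ℝ) : Circle) := by
  have h1 : Function.Periodic (fun x : ℝ => ((F x : ℝ) : Circle)) 1 := by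
    intro x
    simp only [hF, AddCircle.coe_add_period]
  have hG : ∀ x, F.symm (x + 1) = F.symm x + 1 := by
    intro x
    apply F.injective
    rw [hF]; simp
  have h2 : Function.Periodic (fun x : ℝ => ((F.symm x : ℝ) : Circle)) 1 := by
    intro x
    simp only [hG, AddCircle.coe_add_period]
  have c1 : Continuous h1.lift := by
    apply (QuotientAddGroup.isQuotientMap_mk (N := AddSubgroup.zmultiples (1 : ℝ))).continuous_iff.mpr
    exact (AddCircle.continuous_mk' 1).comp F.continuous
  have c2 : Continuous h2.lift := by
    apply (QuotientAddGroup.isQuotientMap_mk (N := AddSubgroup.zmultiples (1 : ℝ))).continuous_iff.mpr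
    exact (AddCircle.continuous_mk' 1).comp F.symm.continuous
  refine ⟨⟨⟨h1.lift, h2.lift, ?_, ?_⟩, c1, c2⟩, fun x => h1.lift_coe x⟩
  · intro q
    induction q using QuotientAddGroup.induction_on with
    | H x =>
      rw [h1.lift_coe, h2.lift_coe]; simp
  · intro q
    induction q using QuotientAddGroup.induction_on with
    | H x =>
      rw [h2.lift_coe, h1.lift_coe]; simp

open Classical in
lemma glue {n : ℕ} (hn : 2 ≤ n) {p : ℝ} (hp : IsNAdic n p) {B r : ℝ → ℝ}
    (Bm : StrictMono B) (Blo : ∀ x, 0 < B x) (Bhi : ∀ x, B x < 1)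
    (Bs : ∀ y, 0 < y → y < 1 → ∃ x, B x = y) (Ba : ∀ j : ℤ, NAff n B j (j + 1))
    (rm : StrictMono r) (rlo : ∀ x, p < r x) (rhi : ∀ x, r x < p + 1)
    (rs : ∀ y, p < y → y < p + 1 → ∃ x, r x = y) (ra : ∀ j : ℤ, NAff n r j (j + 1))
    (hl : ∃ N m : ℤ, ∀ x : ℝ, x ≤ N → r x = p + (n : ℝ) ^ m * B x)
    (hr : ∃ N m : ℤ, ∀ x : ℝ, N ≤ x → r x = p + 1 - (n : ℝ) ^ m * (1 - B x)) :
    ∃ f : Circle ≃ₜ Circle, InT n f ∧ f ((0 : ℝ) : Circle) = (p : Circle) ∧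
      ∀ x, f ((B x : ℝ) : Circle) = ((r x : ℝ) : Circle) := by
  have h0 : (n : ℝ) ≠ 0 := by positivity
  obtain ⟨F, hF0, hF1⟩ : ∃ F : ℝ → ℝ, (∀ m : ℤ, F m = m + p) ∧
      (∀ (m : ℤ) (x : ℝ), F (m + B x) = m + r x) := by
    refine ⟨fun y => ⌊y⌋ + (if h : ∃ x, B x = Int.fract y then r h.choose else p), ?_, ?_⟩
    · intro m
      have : ¬ ∃ x, B x = Int.fract (m : ℝ) := by
        rintro ⟨x, hx⟩
        rw [Int.fract_intCast] at hx
        exact (Blo x).ne' hx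
      simp only [this, dif_neg, not_false_eq_true, Int.floor_intCast]
    · intro m x
      have hf : Int.fract ((m : ℝ) + B x) = B x := by
        rw [Int.fract_intCast_add, Int.fract_eq_self]
        exact ⟨(Blo x).le, Bhi x⟩
      have hfl : ⌊(m : ℝ) + B x⌋ = m := by
        rw [Int.floor_eq_iff]
        constructor <;> linarith [Blo x, Bhi x]
      have h : ∃ x', B x' = Int.fract ((m : ℝ) + B x) := ⟨x, hf.symm⟩
      simp only [h, dif_pos, hfl]
      have h3 := h.choose_spec.trans hf
      rw [Bm.injective h3]
  have cases : ∀ y : ℝ, (∃ m : ℤ, y = m) ∨ ∃ (m : ℤ) (x : ℝ), y = m + B x := by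
    intro y
    rcases (Int.fract_nonneg y).lt_or_eq with h | h
    · obtain ⟨x, hx⟩ := Bs _ h (Int.fract_lt_one y)
      right
      refine ⟨⌊y⌋, x, ?_⟩
      rw [hx, Int.floor_add_fract]
    · left
      refine ⟨⌊y⌋, ?_⟩
      have := Int.floor_add_fract y
      rw [← h] at this
      linarith
  have Fp : ∀ y, F (y + 1) = F y + 1 := by
    intro y
    rcases cases y with ⟨m, rfl⟩ | ⟨m, x, rfl⟩
    · have := hF0 (m + 1)
      push_cast at this
      rw [this, hF0]; ring
    · have := hF1 (m + 1) x
      push_cast at this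
      rw [show (m : ℝ) + B x + 1 = m + 1 + B x by ring, this, hF1]; ring
  have Fmono : StrictMono F := by
    intro y y' hyy
    rcases cases y with ⟨m, rfl⟩ | ⟨m, x, rfl⟩ <;> rcases cases y' with ⟨m', rfl⟩ | ⟨m', x', rfl⟩
    · rw [hF0, hF0]; linarith
    · rw [hF0, hF1]
      have : (m : ℝ) < m' + 1 := by linarith [Bhi x']
      have : m < m' + 1 := by exact_mod_cast this
      have : m ≤ m' := by omega
      have : (m : ℝ) ≤ m' := by exact_mod_cast this
      linarith [rlo x']
    · rw [hF0, hF1]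
      have : (m : ℝ) < m' := by linarith [Blo x]
      have : m + 1 ≤ m' := by exact_mod_cast this
      have : (m : ℝ) + 1 ≤ m' := by exact_mod_cast this
      linarith [rhi x]
    · rw [hF1, hF1]
      have : (m : ℝ) < m' + 1 := by linarith [Bhi x', Blo x]
      have : m < m' + 1 := by exact_mod_cast this
      rcases (show m ≤ m' by omega).lt_or_eq with h | h
      · have : m + 1 ≤ m' := by omega
        have : (m : ℝ) + 1 ≤ m' := by exact_mod_cast this
        linarith [rhi x, rlo x']
      · subst h
        have : B x < B x' := by linarith
        rw [Bm.lt_iff_lt] at this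
        have := rm this
        linarith
  have Fsurj : Function.Surjective F := by
    intro z
    have hz := Int.floor_add_fract (z - p)
    rcases (Int.fract_nonneg (z - p)).lt_or_eq with h | h
    · obtain ⟨x, hx⟩ := rs (p + Int.fract (z - p)) (by linarith) (by linarith [Int.fract_lt_one (z - p)])
      refine ⟨⌊z - p⌋ + B x, ?_⟩
      rw [hF1, hx]; linarith
    · refine ⟨⌊z - p⌋, ?_⟩
      rw [hF0]; linarith
  have Fadic : ∀ y, ∃ (e : ℤ) (c : ℝ), IsNAdic n c ∧ F y = (n : ℝ) ^ e * y + c := by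
    intro y
    rcases cases y with ⟨m, rfl⟩ | ⟨m, x, rfl⟩
    · exact ⟨0, p, hp, by rw [hF0]; simp⟩
    · obtain ⟨e, c, hc, H⟩ := Ba ⌊x⌋
      obtain ⟨e', c', hc', H'⟩ := ra ⌊x⌋
      have q1 := Int.floor_le x
      have q2 := (Int.lt_floor_add_one x).le
      refine ⟨e' - e, m + c' - (n : ℝ) ^ (e' - e) * (m + c), nadic_sub hn (nadic_add hn
        (nadic_int n m) hc') (nadic_mul (nadic_zpow _ _) (nadic_add hn (nadic_int n m) hc)), ?_⟩
      rw [hF1, H x q1 q2, H' x q1 q2, zpow_sub₀ h0]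
      field_simp
      ring
  let O := Fmono.orderIsoOfSurjective F Fsurj
  obtain ⟨f, hf⟩ := circleHomeo O.toHomeomorph (by intro x; exact Fp x)
  have hfF : ∀ x : ℝ, f (x : Circle) = ((F x : ℝ) : Circle) := hf
  refine ⟨f, ⟨?_, F, Fmono, hfF, Fp, ?_⟩, ?_, ?_⟩
  · ext q
    constructor
    · rintro ⟨_, ⟨x, hx, rfl⟩, rfl⟩
      obtain ⟨e, c, hc, H⟩ := Fadic x
      refine ⟨F x, ?_, hfF x⟩
      rw [H]
      exact nadic_add hn (nadic_mul (nadic_zpow _ _) hx) hc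
    · rintro ⟨z, hz, rfl⟩
      obtain ⟨y, rfl⟩ := Fsurj z
      obtain ⟨e, c, hc, H⟩ := Fadic y
      refine ⟨(y : Circle), ⟨y, ?_, rfl⟩, hfF y⟩
      have : y = (n : ℝ) ^ (-e) * (F y - c) := by
        rw [H, zpow_neg]; field_simp; ring
      rw [this]
      exact nadic_mul (nadic_zpow _ _) (nadic_sub hn hz hc)
  · obtain ⟨N, m, hN⟩ := hl
    obtain ⟨N', m', hN'⟩ := hr
    have BN : ∀ j : ℤ, IsNAdic n (B j) := by
      intro j
      obtain ⟨e, c, hc, H⟩ := Ba j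
      rw [H j le_rfl (by linarith)]
      exact nadic_add hn (nadic_mul (nadic_zpow _ _) (nadic_int n j)) hc
    obtain ⟨M, hM⟩ : ∃ M : ℕ, N' ≤ N + M := ⟨(N' - N).toNat, by
      have := Int.self_le_toNat (N' - N); omega⟩
    -- breakpoints
    let t : ℕ → ℝ := fun i => if i = 0 then 0 else if i ≤ M + 1 then B (N + i - 1) else 1
    have F0x : ∀ x, F (B x) = r x := by intro x; have := hF1 0 x; simpa using this
    have F00 : F 0 = p := by have := hF0 0; simpa using this
    have F01 : F 1 = p + 1 := by have := hF0 1; push_cast at this; linarith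
    have piece : ∀ i, i < M + 2 → ∃ (s : ℤ) (c : ℝ), ∀ x ∈ Set.Icc (t i) (t (i + 1)),
        F x = (n : ℝ) ^ s * x + c := by
      intro i hi
      rcases Nat.eq_zero_or_pos i with h | h
      · subst h
        refine ⟨m, p, ?_⟩
        simp only [t, if_true, zero_add, one_ne_zero, if_false, show 1 ≤ M + 1 by omega]
        rintro y ⟨h1, h2⟩
        rcases h1.lt_or_eq with h | h
        · obtain ⟨x, rfl⟩ := Bs y h (h2.trans_lt (Bhi _))
          rw [Bm.le_iff_le] at h2
          push_cast at h2
          rw [F0x, hN x (by linarith)]; ring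
        · rw [← h, F00]; simp
      · rcases (show i ≤ M + 1 by omega).lt_or_eq with h' | h'
        · obtain ⟨e, c, hc, H⟩ := Ba (N + i - 1)
          obtain ⟨e', c', hc', H'⟩ := ra (N + i - 1)
          refine ⟨e' - e, c' - (n : ℝ) ^ (e' - e) * c, ?_⟩
          simp only [t, h.ne', if_false, show i ≤ M + 1 by omega, if_true, Nat.succ_ne_zero,
            show i + 1 ≤ M + 1 by omega]
          rintro y ⟨h1, h2⟩
          obtain ⟨x, rfl⟩ := Bs y ((Blo _).trans_le h1) (h2.trans_lt (Bhi _))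
          rw [Bm.le_iff_le] at h1 h2
          push_cast at h1 h2 H H'
          rw [F0x, H x (by linarith) (by linarith), H' x (by linarith) (by linarith), zpow_sub₀ h0]
          field_simp
          ring
        · refine ⟨m', p + 1 - (n : ℝ) ^ m', ?_⟩
          simp only [t, h.ne', if_false, show i ≤ M + 1 by omega, if_true, Nat.succ_ne_zero,
            show ¬ (i + 1 ≤ M + 1) by omega]
          rintro y ⟨h1, h2⟩
          rcases h2.lt_or_eq with h | h
          · obtain ⟨x, rfl⟩ := Bs y ((Blo _).trans_le h1) h
            rw [Bm.le_iff_le, h'] at h1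
            have hM' : (N' : ℝ) ≤ N + M := by exact_mod_cast hM
            push_cast at h1
            rw [F0x, hN' x (by linarith)]; ring
          · rw [h, F01]; ring
    choose! s c hsc using piece
    refine ⟨M + 2, t, s, c, by omega, by simp [t], by simp [t], ?_, ?_, hsc⟩
    · intro i hi
      rcases Nat.eq_zero_or_pos i with h | h
      · subst h
        simp only [t, if_true, zero_add, one_ne_zero, if_false, show 1 ≤ M + 1 by omega]
        exact Blo _
      · rcases (show i ≤ M + 1 by omega).lt_or_eq with h' | h'
        · simp only [t, h.ne', if_false, show i ≤ M + 1 by omega, if_true, Nat.succ_ne_zero,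
            show i + 1 ≤ M + 1 by omega]
          apply Bm
          push_cast
          linarith
        · simp only [t, h.ne', if_false, show i ≤ M + 1 by omega, if_true, Nat.succ_ne_zero,
            show ¬ (i + 1 ≤ M + 1) by omega]
          exact Bhi _
    · intro i hi
      simp only [t]
      split_ifs
      · simpa using nadic_int n 0
      · have := BN (N + i - 1)
        push_cast at this
        exact this
      · simpa using nadic_int n 1
  · rw [hfF]
    have := hF0 0
    push_cast at this
    rw [this]; simp
  · intro x
    rw [hfF]
    have := hF1 0 x
    push_cast at this
    simp only [zero_add] at this
    rw [this]

def B0 (n : ℕ) (x : ℝ) : ℝ := Bf n 1 x - 1 / n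

def tt {n : ℕ} (d : ℕ) (w : List (Fin n)) : ℤ := (d + dsum w - 1) % ((n : ℤ) - 1)

lemma B0_facts {n : ℕ} (hn : 2 ≤ n) : StrictMono (B0 n) ∧ (∀ x, 0 < B0 n x) ∧ (∀ x, B0 n x < 1) ∧
    (∀ y, 0 < y → y < 1 → ∃ x, B0 n x = y) ∧ (∀ j : ℤ, NAff n (B0 n) j (j + 1)) := by
  have h := Bf_chart (n := n) (d := 1) hn le_rfl (by omega)
  have e : (((1 : ℕ) : ℝ)) / n = 1 / n := by simp
  rw [e] at h
  refine ⟨?_, ?_, ?_, ?_, ?_⟩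
  · intro x y hxy
    have := h.mono hxy
    simp only [B0]; linarith
  · intro x; have := h.lo x; simp only [B0]; linarith
  · intro x; have := h.hi x; simp only [B0]; linarith
  · intro y h1 h2
    obtain ⟨x, hx⟩ := h.surj (y + 1 / n) (by linarith) (by linarith)
    exact ⟨x, by simp only [B0]; linarith⟩
  · intro j
    obtain ⟨e, c, hc, H⟩ := h.aff j
    refine ⟨e, c - 1 / n, nadic_sub hn hc h.nadic, ?_⟩
    intro x h1 h2
    simp only [B0]
    rw [H x h1 h2]; ring

lemma exists_elt {n : ℕ} (hn : 2 ≤ n) {d : ℕ} (hd : 1 ≤ d) (hdn : d < n) (w : List (Fin n)) :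
    ∃ f : Circle ≃ₜ Circle, InT n f ∧ f ((0 : ℝ) : Circle) = (pt d w : Circle) ∧
      ∀ x, f ((B0 n x : ℝ) : Circle) = ((rho d w (x + tt d w) : ℝ) : Circle) := by
  obtain ⟨b1, b2, b3, b4, b5⟩ := B0_facts hn
  have h := rho_chart hn hd hdn w
  set t : ℤ := tt d w with ht
  obtain ⟨q, hq⟩ : ∃ q : ℤ, (d + dsum w - 1 : ℤ) = t + q * (n - 1) := by
    refine ⟨(d + dsum w - 1) / ((n : ℤ) - 1), ?_⟩
    rw [ht, tt, mul_comm, Int.emod_add_mul_ediv]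
  have hq' : (d : ℝ) + dsum w - 1 = t + q * (n - 1) := by exact_mod_cast hq
  refine glue hn h.nadic (r := fun x => rho d w (x + t)) b1 b2 b3 b4 b5 ?_ ?_ ?_ ?_ ?_ ?_ ?_
  · intro x y hxy
    exact h.mono (by linarith)
  · intro x; exact h.lo _
  · intro x; exact h.hi _
  · intro y h1 h2
    obtain ⟨x, hx⟩ := h.surj y h1 h2
    exact ⟨x - t, by simpa using hx⟩
  · intro j
    obtain ⟨e, c, hc, H⟩ := h.aff (j + t)
    refine ⟨e, (n : ℝ) ^ e * t + c, nadic_add hn (nadic_mul (nadic_zpow _ _) (nadic_int n t)) hc, ?_⟩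
    intro x h1 h2
    push_cast at H
    show rho d w (x + t) = _
    rw [H _ (by linarith) (by linarith)]; ring
  · obtain ⟨N, hN⟩ := h.left
    refine ⟨min (N - t) 0, -q, ?_⟩
    intro x hx
    push_cast at hx
    have hx1 := hx.trans (min_le_left _ _)
    have hx2 := hx.trans (min_le_right _ _)
    rw [hN _ (by linarith), B0, Bf_left _ _ _ hx2, Nat.cast_one, add_sub_cancel_left, ← Z_shift hn]
    congr 2
    push_cast
    linarith
  · obtain ⟨N, hN⟩ := h.right
    refine ⟨max (N - t) 0, -(w.length - q), ?_⟩
    intro x hx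
    push_cast at hx
    have hx1 := (le_max_left _ _).trans hx
    have hx2 := (le_max_right _ _).trans hx
    rw [hN _ (by linarith), B0, Bf_right hn le_rfl (by omega) _ hx2, Nat.cast_one]
    have e : (1 : ℝ) - (1 / n + 1 - Z n (x + n - 1) - 1 / n) = Z n (x + n - 1) := by ring
    rw [e, ← Z_shift hn]
    congr 2
    push_cast
    linarith

/-! ### Elements of `T_n` on standard intervals -/

lemma circ_eq (x y : ℝ) : (x : Circle) = (y : Circle) ↔ ∃ m : ℤ, x = y + m := by
  rw [← sub_eq_zero, ← AddCircle.coe_sub, AddCircle.coe_eq_zero_iff]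
  constructor
  · rintro ⟨m, hm⟩
    exact ⟨m, by simp at hm; linarith⟩
  · rintro ⟨m, hm⟩
    exact ⟨m, by simp; linarith⟩

lemma std_intervals {n : ℕ} (hn : 2 ≤ n) {f : Circle ≃ₜ Circle} {F : ℝ → ℝ}
    (h1 : f '' nAdicPoints n = nAdicPoints n) (hl : IsLift f F) (hF : PiecewiseNAffine n F) :
    ∃ k : ℕ, ∀ j : ℤ, 0 ≤ j → j < (n : ℤ) ^ k → ∃ (J : ℤ) (K : ℕ), ∀ z : ℝ, 0 ≤ z → z ≤ 1 →
      F ((j + z) / (n : ℝ) ^ k) = (J + z) / (n : ℝ) ^ K := by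
  have h0 : (n : ℝ) ≠ 0 := by positivity
  obtain ⟨-, m, t, s, c, hm, t0, tm, tlt, tad, hH⟩ := hF
  have Fad : ∀ x, IsNAdic n x → IsNAdic n (F x) := by
    intro x hx
    have : f (x : Circle) ∈ nAdicPoints n := by
      rw [← h1]; exact ⟨_, ⟨x, hx, rfl⟩, rfl⟩
    obtain ⟨y, hy, hxy⟩ := this
    rw [hl x, circ_eq] at hxy
    obtain ⟨q, hq⟩ := hxy
    rw [hq]
    exact nadic_add hn hy (nadic_int n q)
  have cad : ∀ i, i < m → IsNAdic n (c i) := by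
    intro i hi
    have e := hH i hi (t i) ⟨le_rfl, (tlt i hi).le⟩
    have : c i = F (t i) - (n : ℝ) ^ s i * t i := by rw [e]; ring
    rw [this]
    exact nadic_sub hn (Fad _ (tad i hi.le)) (nadic_mul (nadic_zpow _ _) (tad i hi.le))
  have scale : ∀ x, IsNAdic n x → ∃ k0 : ℕ, ∀ k ≥ k0, ∃ a : ℤ, x = a / (n : ℝ) ^ k := by
    rintro x ⟨a, k0, rfl⟩
    refine ⟨k0, fun k hk => ?_⟩
    obtain ⟨l, rfl⟩ := Nat.exists_eq_add_of_le hk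
    refine ⟨a * n ^ l, ?_⟩
    push_cast
    rw [pow_add]
    field_simp
  have ev : ∀ᶠ k : ℕ in Filter.atTop, ∀ i ∈ Finset.range (m + 1),
      (∃ a : ℤ, t i = a / (n : ℝ) ^ k) ∧
      (i < m → ∃ (K : ℕ) (b : ℤ), s i - k = -(K : ℤ) ∧ c i = b / (n : ℝ) ^ K) := by
    rw [Filter.eventually_all_finset]
    intro i hi
    have hi' : i ≤ m := by simpa [Nat.lt_succ_iff] using hi
    obtain ⟨k1, hk1⟩ := scale _ (tad i hi')
    have hk2 : ∃ k2 : ℕ, ∀ k ≥ k2, (i < m → ∃ b : ℤ, c i = b / (n : ℝ) ^ k) := by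
      by_cases him : i < m
      · obtain ⟨k2, hk2⟩ := scale _ (cad i him)
        exact ⟨k2, fun k hk _ => hk2 k hk⟩
      · exact ⟨0, fun k hk h => absurd h him⟩
    obtain ⟨k2, hk2⟩ := hk2
    filter_upwards [Filter.eventually_ge_atTop (k1 + k2 + (s i).toNat)] with k hk
    refine ⟨hk1 k (by omega), fun him => ?_⟩
    have hs := Int.self_le_toNat (s i)
    obtain ⟨b, hb⟩ := hk2 (k - s i).toNat (by omega) him
    exact ⟨(k - s i).toNat, b, by omega, hb⟩
  obtain ⟨k, hk⟩ := ev.exists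
  refine ⟨k, fun j hj0 hj1 => ?_⟩
  have hpk : (0 : ℝ) < (n : ℝ) ^ k := by positivity
  have : ∃ i, i < m ∧ t i ≤ (j : ℝ) / n ^ k ∧ (j : ℝ) / n ^ k < t (i + 1) := by
    by_contra! hcon
    have : ∀ i, i ≤ m → t i ≤ (j : ℝ) / n ^ k := by
      intro i
      induction i with
      | zero => intro _; rw [t0]; exact div_nonneg (by exact_mod_cast hj0) hpk.le
      | succ i ih => intro hi; exact hcon i (by omega) (ih (by omega))
    have h := this m le_rfl
    rw [tm, le_div_iff₀ hpk, one_mul] at h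
    have : (j : ℝ) < (n : ℝ) ^ k := by exact_mod_cast hj1
    linarith
  obtain ⟨i, him, hi1, hi2⟩ := this
  obtain ⟨a, ha⟩ := (hk (i + 1) (by simp; omega)).1
  obtain ⟨K, b, hK, hb⟩ := (hk i (by simp; omega)).2 him
  have hja : (j : ℝ) + 1 ≤ a := by
    rw [ha, div_lt_div_iff_of_pos_right hpk] at hi2
    exact_mod_cast hi2
  refine ⟨j + b, K, fun z hz0 hz1 => ?_⟩
  rw [hH i him _ ⟨?_, ?_⟩, hb]
  · have e : (n : ℝ) ^ s i / (n : ℝ) ^ k = 1 / (n : ℝ) ^ K := by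
      rw [← zpow_natCast, ← zpow_sub₀ h0, hK, zpow_neg, zpow_natCast, one_div]
    have : (n : ℝ) ^ s i * ((j + z) / (n : ℝ) ^ k) = ((n : ℝ) ^ s i / (n : ℝ) ^ k) * (j + z) := by ring
    rw [this, e]
    push_cast
    ring
  · refine hi1.trans ?_
    apply div_le_div_of_nonneg_right _ hpk.le
    linarith
  · rw [ha]
    apply div_le_div_of_nonneg_right _ hpk.le
    linarith

lemma num_bounds {n : ℕ} (u : List (Fin n)) : 0 ≤ num u ∧ num u < (n : ℤ) ^ u.length := by
  induction u with
  | nil => simp [num]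
  | cons c u ih =>
    simp only [num, List.length_cons, pow_succ]
    have h1 : ((c : ℕ) : ℤ) + 1 ≤ n := by exact_mod_cast c.2
    have h2 : (0 : ℤ) ≤ (n : ℤ) ^ u.length := by positivity
    constructor
    · have := ih.1
      positivity
    · nlinarith [ih.2]

lemma transport {n : ℕ} (hn : 2 ≤ n) {F : ℝ → ℝ} (Fm : StrictMono F) (Fp : ∀ x, F (x + 1) = F x + 1)
    (u v : List (Fin n)) (m : ℤ)
    (h : ∀ z : ℝ, 0 ≤ z → z ≤ 1 →
      F ((num u + z) / (n : ℝ) ^ u.length) = (num v + z) / (n : ℝ) ^ v.length + m)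
    {d d' : ℕ} (hd : 1 ≤ d) (hdn : d < n) (hd' : 1 ≤ d') (hdn' : d' < n) (w w' : List (Fin n))
    (y : ℝ) : ∃ y' : ℝ, F (rho d (u ++ w) y) = rho d (v ++ w) y' + m ∧
      F (rho d' (u ++ w') y) = rho d' (v ++ w') y' + m := by
  have left : ∀ (d : ℕ) (w : List (Fin n)), 1 ≤ d → d < n → y ≤ - rsum u →
      F (rho d (u ++ w) y) = rho d (v ++ w) (y + rsum u - rsum v) + m := by
    intro d w hd hdn hy
    have ch := rho_chart hn hd hdn w
    have b1 := ch.lo (y + rsum u)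
    have b2 := pt_pos hn hd w
    have b3 := ch.mono.monotone (show y + rsum u ≤ 0 by linarith)
    rw [ch.zero] at b3
    rw [rho_append_left hn d u w y hy, h _ (by linarith) b3,
      rho_append_left hn d v w _ (by linarith), sub_add_cancel]
  have right : ∀ (d : ℕ) (w : List (Fin n)), 1 ≤ d → d < n → dsum u ≤ y →
      F (rho d (u ++ w) y) = rho d (v ++ w) (y - dsum u + dsum v) + m := by
    intro d w hd hdn hy
    have ch := rho_chart hn hd hdn w
    have b1 := ch.hi (y - dsum u)
    have b2 := pt_lt hn hdn w
    have b3 := ch.mono.monotone (show 0 ≤ y - dsum u by linarith)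
    rw [ch.zero] at b3
    rw [rho_append_right hn hd hdn u w y hy, Fp, add_sub_assoc, h _ (by linarith) (by linarith),
      rho_append_right hn hd hdn v w _ (by linarith), add_sub_cancel_right]
    ring
  rcases le_total y (-rsum u) with hy | hy
  · exact ⟨_, left d w hd hdn hy, left d' w' hd' hdn' hy⟩
  rcases le_total (dsum u : ℝ) y with hy' | hy'
  · exact ⟨_, right d w hd hdn hy', right d' w' hd' hdn' hy'⟩
  -- the middle part
  have cu := rho_chart hn hd hdn (u ++ w)
  have cv := rho_chart hn hd hdn (v ++ w)
  have cw := rho_chart hn hd hdn w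
  have u1 := rho_append_left hn d u w (-rsum u) le_rfl
  have u2 := rho_append_right hn hd hdn u w (dsum u) le_rfl
  have v1 := rho_append_left hn d v w (-rsum v) le_rfl
  have v2 := rho_append_right hn hd hdn v w (dsum v) le_rfl
  rw [neg_add_cancel, cw.zero] at u1 v1
  rw [sub_self, cw.zero, add_sub_cancel_right] at u2 v2
  have m1 := Fm.monotone (cu.mono.monotone hy)
  have m2 := Fm.monotone (cu.mono.monotone hy')
  have e0 := h 0 le_rfl zero_le_one
  rw [add_zero, add_zero] at e0
  rw [u1, h 1 zero_le_one le_rfl, ← v1] at m1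
  rw [u2, Fp, e0] at m2
  obtain ⟨y', hy'1⟩ := cv.surj (F (rho d (u ++ w) y) - m)
    (by linarith [cv.lo (-rsum v)]) (by linarith [cv.hi (dsum v)])
  have k1 : -rsum v ≤ y' := by
    rw [← cv.mono.le_iff_le, hy'1]; linarith
  have k2 : y' ≤ dsum v := by
    rw [← cv.mono.le_iff_le, hy'1]; linarith
  refine ⟨y', by linarith, ?_⟩
  rw [← rho_append_mid hn hd hdn hd' hdn' u w w' y hy hy',
    ← rho_append_mid hn hd hdn hd' hdn' v w w' y' k1 k2]
  linarith

/-! ### Word length -/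

section wl
variable {G : Type*} [Group G]

lemma wl_exists {S : Set G} (hS : Subgroup.closure S = ⊤) (g : G) :
    ∃ w : List G, w.length = wordLength S g ∧ (∀ x ∈ w, x ∈ S ∨ x⁻¹ ∈ S) ∧ w.prod = g := by
  have hne : { k : ℕ | ∃ w : List G, w.length = k ∧ (∀ x ∈ w, x ∈ S ∨ x⁻¹ ∈ S) ∧
      w.prod = g }.Nonempty := by
    have : g ∈ Subgroup.closure S := by rw [hS]; trivial
    rw [← Subgroup.mem_toSubmonoid, Subgroup.closure_toSubmonoid] at this
    obtain ⟨l, h1, h2⟩ := Submonoid.exists_list_of_mem_closure this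
    exact ⟨l.length, l, rfl, fun x hx => by simpa using h1 x hx, h2⟩
  exact Nat.sInf_mem hne

lemma wl_le {S : Set G} (w : List G) (hw : ∀ x ∈ w, x ∈ S ∨ x⁻¹ ∈ S) :
    wordLength S w.prod ≤ w.length :=
  Nat.sInf_le ⟨w, rfl, hw, rfl⟩

lemma wl_mul {S : Set G} (hS : Subgroup.closure S = ⊤) (g h : G) :
    wordLength S (g * h) ≤ wordLength S g + wordLength S h := by
  obtain ⟨a, a1, a2, rfl⟩ := wl_exists hS g
  obtain ⟨b, b1, b2, rfl⟩ := wl_exists hS h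
  rw [← a1, ← b1, ← List.length_append, ← List.prod_append]
  apply wl_le
  intro x hx
  rcases List.mem_append.mp hx with h | h
  · exact a2 x h
  · exact b2 x h

lemma wl_bound {S : Set G} (hS : Subgroup.closure S = ⊤) {E : Set G} (hE : E.Finite) :
    ∃ C : ℕ, ∀ w : List G, (∀ x ∈ w, x ∈ E) → wordLength S w.prod ≤ C * w.length := by
  refine ⟨hE.toFinset.sup (wordLength S), ?_⟩
  intro w
  induction w with
  | nil => intro _; simpa using wl_le (S := S) [] (by simp)
  | cons g w ih =>
    intro h
    rw [List.prod_cons, List.length_cons, mul_add, mul_one, add_comm]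
    refine (wl_mul hS g w.prod).trans (Nat.add_le_add ?_ (ih fun x hx => h x (by simp [hx])))
    exact Finset.le_sup (f := wordLength S) (hE.mem_toFinset.mpr (h g (by simp)))

end wl

/-! ### The transversal -/

/-- action of `T_n` on the circle -/
def ap {n : ℕ} (g : Tn n) (x : Circle) : Circle := (g : Circle ≃ₜ Circle) x

abbrev o : Circle := ((0 : ℝ) : Circle)

section trans
variable {n : ℕ}

lemma ap_mul (g h : Tn n) (x : Circle) : ap (g * h) x = ap g (ap h x) := rfl
lemma ap_one (x : Circle) : ap (1 : Tn n) x = x := rfl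
lemma ap_inj (g : Tn n) {x y : Circle} (h : ap g x = ap g y) : x = y :=
  (g : Circle ≃ₜ Circle).injective h
lemma ap_ext {g h : Tn n} (H : ∀ x, ap g x = ap h x) : g = h :=
  Subtype.ext (Homeomorph.ext H)
lemma ap_fix (e : Fix0 n) : ap (e : Tn n) o = o := e.2

structure IsRep (n : ℕ) (r : Tn n) (d : ℕ) (w : List (Fin n)) : Prop where
  hd : 1 ≤ d
  hdn : d < n
  zero : ap r o = ((pt d w : ℝ) : Circle)
  chart : ∀ x : ℝ, ap r ((B0 n x : ℝ) : Circle) = ((rho d w (x + tt d w) : ℝ) : Circle)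

def Rset (n : ℕ) : Set (Tn n) := { r | r = 1 ∨ ∃ d w, IsRep n r d w }

lemma circle_cases (hn : 2 ≤ n) (q : Circle) : q = o ∨ ∃ x : ℝ, q = ((B0 n x : ℝ) : Circle) := by
  induction q using QuotientAddGroup.induction_on with
  | H y =>
    have e : ((y : ℝ) : Circle) = ((Int.fract y : ℝ) : Circle) := by
      rw [circ_eq]; exact ⟨⌊y⌋, by rw [add_comm, Int.floor_add_fract]⟩
    rcases (Int.fract_nonneg y).lt_or_eq with h | h
    · obtain ⟨x, hx⟩ := (B0_facts hn).2.2.2.1 _ h (Int.fract_lt_one y)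
      right
      exact ⟨x, by rw [hx]; exact e⟩
    · left
      rw [← h] at e
      exact e

lemma eq_of_unit {x y : ℝ} (hx : 0 ≤ x) (hx1 : x < 1) (hy : 0 ≤ y) (hy1 : y < 1)
    (h : (x : Circle) = (y : Circle)) : x = y := by
  obtain ⟨m, hm⟩ := (circ_eq x y).mp h
  have h1 : (m : ℝ) < 1 := by linarith
  have h2 : (-1 : ℝ) < m := by linarith
  have h1' : m < 1 := by exact_mod_cast h1
  have h2' : -1 < m := by exact_mod_cast h2
  have : m = 0 := by omega
  subst this
  simpa using hm

lemma rep_unique (hn : 2 ≤ n) {r r' : Tn n} {d : ℕ} {w : List (Fin n)} (h : IsRep n r d w)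
    (h' : IsRep n r' d w) : r = r' := by
  apply ap_ext
  intro q
  rcases circle_cases hn q with rfl | ⟨x, rfl⟩
  · rw [h.zero, h'.zero]
  · rw [h.chart, h'.chart]

lemma R_inj (hn : 2 ≤ n) {r r' : Tn n} (h : r ∈ Rset n) (h' : r' ∈ Rset n)
    (e : ap r o = ap r' o) : r = r' := by
  rcases h with rfl | ⟨d, w, h⟩ <;> rcases h' with rfl | ⟨d', w', h'⟩
  · rfl
  · rw [ap_one, h'.zero] at e
    have := eq_of_unit le_rfl one_pos (pt_pos hn h'.hd w').le (pt_lt hn h'.hdn w') e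
    exact absurd this (pt_pos hn h'.hd w').ne
  · rw [ap_one, h.zero] at e
    have := eq_of_unit (pt_pos hn h.hd w).le (pt_lt hn h.hdn w) le_rfl one_pos e
    exact absurd this (pt_pos hn h.hd w).ne'
  · rw [h.zero, h'.zero] at e
    have := eq_of_unit (pt_pos hn h.hd w).le (pt_lt hn h.hdn w)
      (pt_pos hn h'.hd w').le (pt_lt hn h'.hdn w') e
    obtain ⟨rfl, rfl⟩ := pt_inj hn h.hd h.hdn h'.hd h'.hdn w w' this
    exact rep_unique hn h h'

lemma rep_exists (hn : 2 ≤ n) {d : ℕ} (hd : 1 ≤ d) (hdn : d < n) (w : List (Fin n)) :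
    ∃ r : Tn n, IsRep n r d w := by
  obtain ⟨f, h1, h2, h3⟩ := exists_elt hn hd hdn w
  exact ⟨⟨f, Subgroup.subset_closure h1⟩, hd, hdn, h2, h3⟩

lemma R_cover (hn : 2 ≤ n) (q : Circle) (hq : q ∈ nAdicPoints n) : ∃ r ∈ Rset n, ap r o = q := by
  obtain ⟨y, hy, rfl⟩ := hq
  have e : ((y : ℝ) : Circle) = ((Int.fract y : ℝ) : Circle) := by
    rw [circ_eq]; exact ⟨⌊y⌋, by rw [add_comm, Int.floor_add_fract]⟩
  rcases (Int.fract_nonneg y).lt_or_eq with h | h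
  · obtain ⟨d, hd, hdn, w, hw⟩ := exists_code hn (Int.fract y)
      (nadic_sub hn hy (nadic_int n ⌊y⌋)) h (Int.fract_lt_one y)
    obtain ⟨r, hr⟩ := rep_exists hn hd hdn w
    exact ⟨r, Or.inr ⟨d, w, hr⟩, by rw [hr.zero, e, hw]⟩
  · refine ⟨1, Or.inl rfl, ?_⟩
    rw [← h] at e
    exact e.symm

lemma Tn_nadic (g : Tn n) : (g : Circle ≃ₜ Circle) '' nAdicPoints n = nAdicPoints n := by
  obtain ⟨g, hg⟩ := g
  show g '' nAdicPoints n = nAdicPoints n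
  unfold Tn at hg
  induction hg using Subgroup.closure_induction with
  | mem x hx => exact hx.1
  | one => exact Set.image_id _
  | mul x y _ _ hx hy =>
    have : (x * y : Circle ≃ₜ Circle) '' nAdicPoints n = x '' (y '' nAdicPoints n) := by
      rw [Set.image_image]; rfl
    rw [this, hy, hx]
  | inv x _ hx =>
    have : (x⁻¹ : Circle ≃ₜ Circle) '' (x '' nAdicPoints n) = nAdicPoints n := by
      rw [Set.image_image]
      have : ∀ q, (x⁻¹ : Circle ≃ₜ Circle) (x q) = q := fun q => x.symm_apply_apply q
      simp [this]
    rwa [hx] at this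

lemma R_cover' (hn : 2 ≤ n) (g : Tn n) (r : Tn n) : ∃ r' ∈ Rset n, ap r' o = ap g (ap r o) := by
  apply R_cover hn
  rw [← ap_mul, ← Tn_nadic (g * r)]
  exact ⟨o, ⟨0, by simpa using nadic_int n 0, rfl⟩, rfl⟩

/-- the cocycle property -/
def Good (s : Tn n) : Prop :=
  ∃ E : Set (Fix0 n), E.Finite ∧ ∀ r ∈ Rset n, ∃ r' ∈ Rset n, ∃ e ∈ E, s * r = r' * (e : Tn n)

lemma sub_single (hn : 2 ≤ n) (s r : Tn n) :
    { e : Fix0 n | ∃ r' ∈ Rset n, s * r = r' * (e : Tn n) }.Subsingleton := by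
  rintro e ⟨r1, h1, e1⟩ e' ⟨r2, h2, e2⟩
  have k1 : ap s (ap r o) = ap r1 o := by
    rw [← ap_mul, e1, ap_mul, ap_fix]
  have k2 : ap s (ap r o) = ap r2 o := by
    rw [← ap_mul, e2, ap_mul, ap_fix]
  have := R_inj hn h1 h2 (k1.symm.trans k2)
  subst this
  rw [e1] at e2
  exact Subtype.ext (mul_left_cancel e2)

lemma good_of_InT (hn : 2 ≤ n) (s : Tn n) (hs : InT n (s : Circle ≃ₜ Circle)) : Good s := by
  obtain ⟨hs1, F, Fm, hl, hF⟩ := hs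
  obtain ⟨k, hk⟩ := std_intervals hn hs1 hl hF
  have Fp := hF.1
  have hv : ∀ u : List (Fin n), u.length = k → ∃ (v : List (Fin n)) (m : ℤ), ∀ z : ℝ, 0 ≤ z → z ≤ 1 →
      F ((num u + z) / (n : ℝ) ^ u.length) = (num v + z) / (n : ℝ) ^ v.length + m := by
    intro u hu
    have hb := num_bounds u
    rw [hu] at hb
    obtain ⟨J, K, H⟩ := hk (num u) hb.1 hb.2
    obtain ⟨v, m, hvK, hJ⟩ := exists_word hn K J
    refine ⟨v, m, fun z h1 h2 => ?_⟩
    have h0 : (n : ℝ) ≠ 0 := by positivity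
    rw [hu, H z h1 h2, hvK, hJ]
    push_cast
    field_simp
    ring
  choose! V M hVM using hv
  let E : Set (Fix0 n) := { e | ∃ r ∈ Rset n, ∃ r' ∈ Rset n, s * r = r' * (e : Tn n) }
  refine ⟨E, ?_, ?_⟩
  swap
  · intro r hr
    obtain ⟨r', hr', e'⟩ := R_cover' hn s r
    have hfix : r'⁻¹ * (s * r) ∈ Fix0 n := by
      show ap (r'⁻¹ * (s * r)) o = o
      apply ap_inj r'
      rw [← ap_mul, mul_inv_cancel_left, e', ap_mul]
    exact ⟨r', hr', ⟨_, hfix⟩, ⟨r, hr, r', hr', by simp⟩, by simp⟩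
  let D : List (Fin n) × ℤ × ℤ → Set (Fix0 n) := fun x =>
    { e | ∃ d w r, IsRep n r d (x.1 ++ w) ∧ tt d (x.1 ++ w) = x.2.1 ∧ tt d (V x.1 ++ w) = x.2.2 ∧
      ∃ r' ∈ Rset n, s * r = r' * (e : Tn n) }
  let I1 : Set (ℕ × List (Fin n)) := Set.Iio n ×ˢ { w | w.length < k }
  let I2 : Set (List (Fin n) × ℤ × ℤ) := { u | u.length = k } ×ˢ (Set.Icc 0 (n : ℤ) ×ˢ Set.Icc 0 (n : ℤ))
  have fI1 : I1.Finite := (Set.finite_Iio n).prod (List.finite_length_lt _ k)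
  have fI2 : I2.Finite := (List.finite_length_eq _ k).prod ((Set.finite_Icc _ _).prod (Set.finite_Icc _ _))
  have htt : ∀ (d : ℕ) (w : List (Fin n)), tt d w ∈ Set.Icc 0 (n : ℤ) := by
    intro d w
    have hp : (0 : ℤ) < (n : ℤ) - 1 := by omega
    have h1 := Int.emod_nonneg (d + dsum w - 1) hp.ne'
    have h2 := Int.emod_lt_of_pos (d + dsum w - 1) hp
    exact ⟨h1, by unfold tt; omega⟩
  have cover : E ⊆ { e : Fix0 n | ∃ r' ∈ Rset n, s * 1 = r' * (e : Tn n) } ∪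
      ((⋃ x ∈ I1, { e : Fix0 n | ∃ r, IsRep n r x.1 x.2 ∧ ∃ r' ∈ Rset n, s * r = r' * (e : Tn n) }) ∪
      ⋃ x ∈ I2, D x) := by
    rintro e ⟨r, hr, r', hr', he⟩
    rcases hr with rfl | ⟨d, w, h⟩
    · exact Or.inl ⟨r', hr', he⟩
    · right
      rcases lt_or_ge w.length k with hw | hw
      · left
        rw [Set.mem_iUnion₂]
        exact ⟨(d, w), ⟨h.hdn, hw⟩, r, h, r', hr', he⟩
      · right
        rw [Set.mem_iUnion₂]
        have hsplit := List.take_append_drop k w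
        refine ⟨(w.take k, tt d w, tt d (V (w.take k) ++ w.drop k)),
          ⟨by simp [hw], htt _ _, htt _ _⟩, d, w.drop k, r, ?_, ?_, rfl, r', hr', he⟩
        · simpa only [hsplit] using h
        · simp only [hsplit]
  refine Set.Finite.subset ?_ cover
  refine ((sub_single hn s 1).finite).union ((fI1.biUnion ?_).union (fI2.biUnion ?_))
  · rintro ⟨d, w⟩ -
    apply Set.Subsingleton.finite
    rintro e ⟨r, h, he⟩ e' ⟨r', h', he'⟩
    have := rep_unique hn h h'
    subst this
    exact sub_single hn s r he he'
  · rintro ⟨u, t, t'⟩ ⟨hu, -⟩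
    have hu' : u.length = k := hu
    apply Set.Subsingleton.finite
    have H := hVM u hu'
    -- identify `r'`
    have ident : ∀ (d : ℕ) (w : List (Fin n)) (r r' : Tn n) (e : Fix0 n), IsRep n r d (u ++ w) →
        r' ∈ Rset n → s * r = r' * (e : Tn n) → IsRep n r' d (V u ++ w) := by
      intro d w r r' e h hr' he
      obtain ⟨r1, h1⟩ := rep_exists hn h.hd h.hdn (V u ++ w)
      have : r' = r1 := by
        apply R_inj hn hr' (Or.inr ⟨_, _, h1⟩)
        have k1 : ap s (ap r o) = ap r' o := by
          rw [← ap_mul, he, ap_mul, ap_fix]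
        rw [← k1, h.zero, h1.zero]
        have k2 : ap s ((pt d (u ++ w) : ℝ) : Circle) = ((F (pt d (u ++ w)) : ℝ) : Circle) := hl _
        rw [k2, circ_eq]
        refine ⟨M u, ?_⟩
        rw [pt_append hn, H _ (pt_pos hn h.hd w).le (pt_lt hn h.hdn w).le, pt_append hn]
      rw [this]
      exact h1
    rintro e1 ⟨d1, w1, r1, h1, a1, b1, r1', hr1', he1⟩ e2 ⟨d2, w2, r2, h2, a2, b2, r2', hr2', he2⟩
    have i1 := ident d1 w1 r1 r1' e1 h1 hr1' he1
    have i2 := ident d2 w2 r2 r2' e2 h2 hr2' he2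
    simp only at h1 a1 b1 h2 a2 b2
    apply Subtype.ext
    apply ap_ext
    intro q
    rcases circle_cases hn q with rfl | ⟨x, rfl⟩
    · rw [ap_fix, ap_fix]
    · obtain ⟨y', hy1, hy2⟩ := transport hn Fm Fp u (V u) (M u) H h1.hd h1.hdn h2.hd h2.hdn w1 w2 (x + t)
      have main : ∀ (d : ℕ) (w : List (Fin n)) (r r' : Tn n) (e : Fix0 n), IsRep n r d (u ++ w) →
          tt d (u ++ w) = t → tt d (V u ++ w) = t' → IsRep n r' d (V u ++ w) →
          s * r = r' * (e : Tn n) →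
          F (rho d (u ++ w) (x + t)) = rho d (V u ++ w) y' + M u →
          ap (e : Tn n) ((B0 n x : ℝ) : Circle) = ((B0 n (y' - t') : ℝ) : Circle) := by
        intro d w r r' e h a b i he hy
        apply ap_inj r'
        rw [← ap_mul, ← he, ap_mul, h.chart, i.chart, a, b, sub_add_cancel]
        have k2 : ap s ((rho d (u ++ w) (x + t) : ℝ) : Circle) =
          ((F (rho d (u ++ w) (x + t)) : ℝ) : Circle) := hl _
        rw [k2, circ_eq]
        exact ⟨M u, hy⟩
      rw [main d1 w1 r1 r1' e1 h1 a1 b1 i1 he1 hy1, main d2 w2 r2 r2' e2 h2 a2 b2 i2 he2 hy2]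

lemma good_one : Good (1 : Tn n) :=
  ⟨{1}, Set.finite_singleton _, fun r hr => ⟨r, hr, 1, rfl, by simp⟩⟩

lemma good_mul {a b : Tn n} (ha : Good a) (hb : Good b) : Good (a * b) := by
  obtain ⟨E, hE, HE⟩ := ha
  obtain ⟨E', hE', HE'⟩ := hb
  refine ⟨Set.image2 (· * ·) E E', hE.image2 _ hE', fun r hr => ?_⟩
  obtain ⟨r1, hr1, e1, he1, h1⟩ := HE' r hr
  obtain ⟨r2, hr2, e2, he2, h2⟩ := HE r1 hr1
  refine ⟨r2, hr2, e2 * e1, ⟨e2, he2, e1, he1, rfl⟩, ?_⟩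
  rw [mul_assoc, h1, ← mul_assoc, h2, mul_assoc]
  rfl

lemma good_inv (hn : 2 ≤ n) {a : Tn n} (ha : Good a) : Good a⁻¹ := by
  obtain ⟨E, hE, HE⟩ := ha
  refine ⟨(fun e => e⁻¹) '' E, hE.image _, fun r hr => ?_⟩
  obtain ⟨r', hr', e'⟩ := R_cover' hn a⁻¹ r
  obtain ⟨r1, hr1, e1, he1, h1⟩ := HE r' hr'
  have : r1 = r := by
    apply R_inj hn hr1 hr
    have k1 : ap a (ap r' o) = ap r1 o := by
      rw [← ap_mul, h1, ap_mul, ap_fix]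
    rw [← k1, e', ← ap_mul, mul_inv_cancel, ap_one]
  subst this
  refine ⟨r', hr', e1⁻¹, ⟨e1, he1, rfl⟩, ?_⟩
  have : r' = a⁻¹ * (r1 * (e1 : Tn n)) := by rw [← h1]; simp
  rw [this]
  simp [mul_assoc]

lemma good_all (hn : 2 ≤ n) (s : Tn n) : Good s := by
  obtain ⟨g, hg⟩ := s
  have hg' := hg
  unfold Tn at hg'
  induction hg' using Subgroup.closure_induction with
  | mem x hx => exact good_of_InT hn _ hx
  | one => exact good_one
  | mul x y hx hy ihx ihy => exact good_mul (ihx hx) (ihy hy)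
  | inv x hx ihx => exact good_inv hn (ihx hx)

lemma retract (hn : 2 ≤ n) (T : Set (Tn n)) (hT : T.Finite) :
    ∃ E : Set (Fix0 n), E.Finite ∧ ∀ w : List (Tn n), (∀ x ∈ w, x ∈ T ∨ x⁻¹ ∈ T) →
      ∀ ω : Fix0 n, w.prod = (ω : Tn n) →
      ∃ l : List (Fix0 n), l.length = w.length ∧ (∀ x ∈ l, x ∈ E) ∧ l.prod = ω := by
  choose E hE HE using good_all (n := n) hn
  let T' : Set (Tn n) := T ∪ (fun x => x⁻¹) '' T
  have hT' : T'.Finite := hT.union (hT.image _)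
  refine ⟨⋃ x ∈ T', E x, hT'.biUnion fun x _ => hE x, ?_⟩
  intro w hw ω hω
  have key : ∀ w : List (Tn n), (∀ x ∈ w, x ∈ T ∨ x⁻¹ ∈ T) →
      ∃ r ∈ Rset n, ∃ l : List (Fix0 n), l.length = w.length ∧ (∀ x ∈ l, x ∈ ⋃ x ∈ T', E x) ∧
        w.prod = r * ((l.prod : Fix0 n) : Tn n) := by
    intro w
    induction w with
    | nil => intro _; exact ⟨1, Or.inl rfl, [], rfl, by simp, by simp⟩
    | cons g w ih =>
      intro hw
      obtain ⟨r, hr, l, h1, h2, h3⟩ := ih fun x hx => hw x (by simp [hx])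
      obtain ⟨r', hr', e, he, h4⟩ := HE g r hr
      have hg : g ∈ T' := by
        rcases hw g (by simp) with h | h
        · exact Or.inl h
        · exact Or.inr ⟨g⁻¹, h, by simp⟩
      refine ⟨r', hr', e :: l, by simp [h1], ?_, ?_⟩
      · intro x hx
        rcases List.mem_cons.mp hx with rfl | hx
        · rw [Set.mem_iUnion₂]; exact ⟨g, hg, he⟩
        · exact h2 x hx
      · rw [List.prod_cons, h3, ← mul_assoc, h4, List.prod_cons, mul_assoc]
        rfl
  obtain ⟨r, hr, l, h1, h2, h3⟩ := key w hw
  refine ⟨l, h1, h2, ?_⟩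
  have : r = 1 := by
    apply R_inj hn hr (Or.inl rfl)
    have := congrArg (fun g => ap g o) (hω.symm.trans h3)
    simp only [ap_mul, ap_fix] at this
    rw [← this, ap_one]
  rw [this, one_mul, hω] at h3
  exact (Subtype.ext h3).symm

end trans

/-- Let `n ≥ 2` and let `H` be the subgroup of `T_n` of elements
fixing the point `0` (a copy of `F_n` inside `T_n`).  Then `H` is undistorted in `T_n`:
for any finite generating set `S` of `H` and any finite generating set `Σ` of `T_n`,
there exist constants `A ≥ 1` and `B ≥ 0` such that for all `ω ∈ H`,
`(1/A)·|ω|_S - B ≤ |ω|_Σ ≤ A·|ω|_S + B`. -/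
theorem Fn_undistorted_in_Tn (n : ℕ) (hn : 2 ≤ n)
    (S : Finset (Fix0 n)) (hS : Subgroup.closure (S : Set (Fix0 n)) = ⊤)
    (T : Finset (Tn n)) (hT : Subgroup.closure (T : Set (Tn n)) = ⊤) :
    ∃ A B : ℝ, 1 ≤ A ∧ 0 ≤ B ∧ ∀ ω : Fix0 n,
      (1 / A) * (wordLength (S : Set (Fix0 n)) ω : ℝ) - B ≤
          (wordLength (T : Set (Tn n)) (ω : Tn n) : ℝ) ∧
      (wordLength (T : Set (Tn n)) (ω : Tn n) : ℝ) ≤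
          A * (wordLength (S : Set (Fix0 n)) ω : ℝ) + B := by
  obtain ⟨E, hE, HE⟩ := retract hn (T : Set (Tn n)) T.finite_toSet
  obtain ⟨C, hC⟩ := wl_bound hS hE
  let X : Set (Tn n) := (fun x : Fix0 n => (x : Tn n)) '' ((S : Set (Fix0 n)) ∪ (fun x => x⁻¹) '' (S : Set (Fix0 n)))
  have hX : X.Finite := (S.finite_toSet.union (S.finite_toSet.image _)).image _
  obtain ⟨C', hC'⟩ := wl_bound hT hX
  have hCr : (0 : ℝ) ≤ C := by positivity
  have hCr' : (0 : ℝ) ≤ C' := by positivity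
  refine ⟨1 + C + C', 0, by linarith, le_rfl, ?_⟩
  intro ω
  have hA : (0 : ℝ) < 1 + C + C' := by linarith
  constructor
  · obtain ⟨w, w1, w2, w3⟩ := wl_exists hT (ω : Tn n)
    obtain ⟨l, l1, l2, l3⟩ := HE w w2 ω w3
    have h := hC l l2
    rw [l3, l1, w1] at h
    have h' : (wordLength (S : Set (Fix0 n)) ω : ℝ) ≤ C * wordLength (T : Set (Tn n)) (ω : Tn n) := by
      exact_mod_cast h
    have hp : (0 : ℝ) ≤ wordLength (T : Set (Tn n)) (ω : Tn n) := by positivity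
    rw [sub_zero, one_div, inv_mul_le_iff₀ hA]
    nlinarith
  · obtain ⟨w, w1, w2, w3⟩ := wl_exists hS ω
    have h := hC' (w.map (fun x : Fix0 n => (x : Tn n))) (by
      intro x hx
      obtain ⟨y, hy, rfl⟩ := List.mem_map.mp hx
      refine ⟨y, ?_, rfl⟩
      rcases w2 y hy with h | h
      · exact Or.inl h
      · exact Or.inr ⟨y⁻¹, h, by simp⟩)
    have e : (w.map (fun x : Fix0 n => (x : Tn n))).prod = (ω : Tn n) := by
      rw [← w3]
      exact ((Fix0 n).subtype.map_list_prod w).symm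
    rw [e, List.length_map, w1] at h
    have h' : (wordLength (T : Set (Tn n)) (ω : Tn n) : ℝ) ≤ C' * wordLength (S : Set (Fix0 n)) ω := by
      exact_mod_cast h
    have hp : (0 : ℝ) ≤ wordLength (S : Set (Fix0 n)) ω := by positivity
    nlinarith

end ThompsonPaper
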